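/- (Off-diagonal fourfold product bound.) Assume BH(s,r) holds for some 3/2 < s < 2 and r < s', and adopt the decoupling setup with 𝓚 ⊆ 𝓚(ε) such that 𝓚 and {J(K) : K ∈ 𝓚} are A log δ^{-1}-separated for a large admissible constant A. Let K₁, K₂, K₃, K₄ ∈ 𝓚, not all equal, labeled so that K₁ + J(K₁) is minimal among the K_i + J(K_i) (hence |Ω(K₁)| is maximal) and |K₁ − K₄| ≥ (1/2)|K_i − K_j| for all i, j. Then there is an admissible constant c₀ > 0 with ∥ ∏_{i=1}^4 𝓔χ_{Ω_δ(K_i)} ∥_{L^{s/2}(ℝ³)} ≲ 2^{-c₀|K₁−K₄|} |Ω(K₁)|^{4/s'}. -/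

import Mathlib

open MeasureTheory Set
open scoped ENNReal

/-- The extension operator for the hyperbolic paraboloid `τ = ξ₁ξ₂` in `ℝ³`:
`𝓔f(t,x) = ∫_{ℝ²} e^{i(tξ₁ξ₂ + x·ξ)} f(ξ) dξ`. -/
noncomputable def extOp (f : ℝ × ℝ → ℂ) (p : ℝ × ℝ × ℝ) : ℂ :=
  ∫ ξ : ℝ × ℝ,
    Complex.exp (Complex.I * (p.1 * ξ.1 * ξ.2 + p.2.1 * ξ.1 + p.2.2 * ξ.2 : ℝ)) * f ξ

/-- Characteristic function of a set, valued in `ℂ`. -/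
noncomputable def chi (Ω : Set (ℝ × ℝ)) : ℝ × ℝ → ℂ := Ω.indicator fun _ => 1

/-- The axis-parallel unit square with lower-left corner `(a, b)`. -/
def unitSq (a b : ℝ) : Set (ℝ × ℝ) := Icc a (a + 1) ×ˢ Icc b (b + 1)

/-- Bilinear hypothesis BH(s,r) with constant `A`: a bilinear adjoint restriction estimate
`∥𝓔f·𝓔g∥_{L^s} ≤ A ∥f∥_{L^r} ∥g∥_{L^r}` whenever `f, g` are supported in `1 × 1`
axis-parallel squares whose projections onto each coordinate axis are separated by a
distance between `1` and `4` (equivalently, the corners satisfy `2 ≤ |aᵢ - bᵢ| ≤ 5`). -/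
def BH (s r A : ℝ) : Prop :=
  ∀ a₁ a₂ b₁ b₂ : ℝ, 2 ≤ |a₁ - b₁| → |a₁ - b₁| ≤ 5 → 2 ≤ |a₂ - b₂| → |a₂ - b₂| ≤ 5 →
    ∀ f g : ℝ × ℝ → ℂ,
      Function.support f ⊆ unitSq a₁ a₂ → Function.support g ⊆ unitSq b₁ b₂ →
      eLpNorm (fun p => extOp f p * extOp g p) (ENNReal.ofReal s) volume ≤
        ENNReal.ofReal A * eLpNorm f (ENNReal.ofReal r) volume *
          eLpNorm g (ENNReal.ofReal r) volume

/-- The dyadic interval `[m·2⁻ⁿ, (m+1)·2⁻ⁿ]`. -/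
def dyadicIcc (n m : ℤ) : Set ℝ := Icc ((m : ℝ) * 2 ^ (-n)) (((m : ℝ) + 1) * 2 ^ (-n))

/-- A tile in `𝓓_{j,k}`: a product of a dyadic interval of length `2⁻ʲ` with one of
length `2⁻ᵏ`. -/
def tile (j k m m' : ℤ) : Set (ℝ × ℝ) := dyadicIcc j m ×ˢ dyadicIcc k m'

/-- A dyadic number is one of the form `2ⁿ`, `n ∈ ℤ`. -/
def IsDyadic (x : ℝ) : Prop := ∃ n : ℤ, x = 2 ^ n

/-- The vertical fiber of `Ω ⊆ ℝ²` over `x`: `{η : (x, η) ∈ Ω}`. -/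
def vFiber (Ω : Set (ℝ × ℝ)) (x : ℝ) : Set ℝ := {y | (x, y) ∈ Ω}

/-- `Ω(K) = {ξ ∈ Ω : 2^{-K-1} ≤ 𝓗¹({η : (ξ₁,η) ∈ Ω}) ≤ 2^{-K+1}}`, the piece of `Ω` whose
vertical fibers have length about `2⁻ᴷ`. -/
noncomputable def fiberPiece (Ω : Set (ℝ × ℝ)) (K : ℕ) : Set (ℝ × ℝ) :=
  {ξ ∈ Ω | (2 : ℝ≥0∞) ^ (-(K : ℤ) - 1) ≤ volume (vFiber Ω ξ.1) ∧
    volume (vFiber Ω ξ.1) ≤ (2 : ℝ≥0∞) ^ (-(K : ℤ) + 1)}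

/-- `VargasBound s Ω c` says `∥𝓔χ_{Ω'}∥_{L^{2s}} ≤ c·|Ω|^{1/s'}` for every measurable
`Ω' ⊆ Ω` (here `1/s' = 1 - 1/s`). -/
def VargasBound (s : ℝ) (Ω : Set (ℝ × ℝ)) (c : ℝ) : Prop :=
  ∀ Ω' ⊆ Ω, MeasurableSet Ω' →
    eLpNorm (extOp (chi Ω')) (ENNReal.ofReal (2 * s)) volume ≤
      ENNReal.ofReal c * volume Ω ^ (1 - 1 / s)

/-- `𝓚(ε)`: the set of `K ≥ 0` for which `ε` is the smallest dyadic number such that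
`∥𝓔χ_{Ω'}∥_{L^{2s}} ≤ ε·|Ω(K)|^{1/s'}` holds for all measurable `Ω' ⊆ Ω(K)`. -/
def KsetOf (s : ℝ) (Ω : Set (ℝ × ℝ)) (ε : ℝ) : Set ℕ :=
  {K | VargasBound s (fiberPiece Ω K) ε ∧
    ∀ ε' : ℝ, IsDyadic ε' → ε' < ε → ¬ VargasBound s (fiberPiece Ω K) ε'}

theorem sm_extOp {S : Set (ℝ × ℝ)} (hS : MeasurableSet S) :
    StronglyMeasurable (extOp (chi S)) := by
  unfold extOp
  apply StronglyMeasurable.integral_prod_right' (f := fun q : (ℝ × ℝ × ℝ) × (ℝ × ℝ) =>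
    Complex.exp (Complex.I * (q.1.1 * q.2.1 * q.2.2 + q.1.2.1 * q.2.1 + q.1.2.2 * q.2.2 : ℝ)) * chi S q.2)
  apply StronglyMeasurable.mul
  · apply Continuous.stronglyMeasurable
    fun_prop
  · have : StronglyMeasurable (chi S) := stronglyMeasurable_const.indicator hS
    exact this.comp_measurable measurable_snd

theorem int_extOp {S : Set (ℝ × ℝ)} (hS : MeasurableSet S) (hf : volume S ≠ ∞) (p : ℝ × ℝ × ℝ) :
    Integrable (fun ξ : ℝ × ℝ =>
    Complex.exp (Complex.I * (p.1 * ξ.1 * ξ.2 + p.2.1 * ξ.1 + p.2.2 * ξ.2 : ℝ)) * chi S ξ) := by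
  have h1 : Integrable (chi S) := by
    unfold chi
    rw [integrable_indicator_iff hS]
    exact integrableOn_const hf
  refine h1.bdd_mul (c := 1) ?_ ?_
  · apply Continuous.aestronglyMeasurable
    fun_prop
  · filter_upwards with ξ
    rw [mul_comm, Complex.norm_exp_ofReal_mul_I]

theorem split_extOp {S : Set (ℝ × ℝ)} (hS : MeasurableSet S) (hf : volume S ≠ ∞)
    {B : Set (ℝ × ℝ)} (hB : MeasurableSet B) (p : ℝ × ℝ × ℝ) :
    extOp (chi S) p = extOp (chi (S ∩ B)) p + extOp (chi (S \ B)) p := by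
  unfold extOp
  rw [← integral_add]
  · congr 1
    ext ξ
    rw [← mul_add]
    congr 1
    unfold chi
    by_cases h1 : ξ ∈ S <;> by_cases h2 : ξ ∈ B <;> simp [h1, h2]
  · exact int_extOp (hS.inter hB) (measure_ne_top_of_subset inter_subset_left hf) p
  · exact int_extOp (hS.diff hB) (measure_ne_top_of_subset sdiff_subset hf) p

theorem enorm_extOp_le {S : Set (ℝ × ℝ)} (hS : MeasurableSet S) (p : ℝ × ℝ × ℝ) :
    ‖extOp (chi S) p‖ₑ ≤ volume S := by
  unfold extOp
  refine (enorm_integral_le_lintegral_enorm _).trans ?_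
  calc _ = ∫⁻ ξ, S.indicator (fun _ => 1) ξ := by
        congr 1
        ext ξ
        rw [enorm_mul]
        have : ‖Complex.exp (Complex.I * (p.1 * ξ.1 * ξ.2 + p.2.1 * ξ.1 + p.2.2 * ξ.2 : ℝ))‖ₑ = 1 := by
          rw [← ofReal_norm, mul_comm, Complex.norm_exp_ofReal_mul_I]; simp
        rw [this, one_mul]
        unfold chi
        by_cases h1 : ξ ∈ S <;> simp [h1]
    _ = volume S := by rw [lintegral_indicator_const hS, one_mul]
    _ ≤ _ := le_rfl

theorem extOp_empty (p : ℝ × ℝ × ℝ) : extOp (chi ∅) p = 0 := by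
  simp [extOp, chi]

/-- anisotropic dilation of the plane -/
def dil (a b : ℝ) (ξ : ℝ × ℝ) : ℝ × ℝ := (a * ξ.1, b * ξ.2)

/-- the corresponding dilation of space-time -/
def dil3 (a b : ℝ) (p : ℝ × ℝ × ℝ) : ℝ × ℝ × ℝ := (a * b * p.1, a * p.2.1, b * p.2.2)

theorem meas_dil (a b : ℝ) : Measurable (dil a b) := by unfold dil; fun_prop
theorem meas_dil3 (a b : ℝ) : Measurable (dil3 a b) := by unfold dil3; fun_prop

theorem map_dil {a b : ℝ} (ha : 0 < a) (hb : 0 < b) :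
    Measure.map (dil a b) volume = ENNReal.ofReal (a * b)⁻¹ • volume := by
  have : dil a b = Prod.map (a * ·) (b * ·) := rfl
  rw [this, Measure.volume_eq_prod, ← Measure.map_prod_map _ _ (by fun_prop) (by fun_prop),
    Real.map_volume_mul_left ha.ne', Real.map_volume_mul_left hb.ne',
    Measure.prod_smul_left, Measure.prod_smul_right, smul_smul, ← ENNReal.ofReal_mul (by positivity)]
  congr 2
  rw [abs_of_pos (by positivity), abs_of_pos (by positivity), mul_inv]

theorem map_dil3 {a b : ℝ} (ha : 0 < a) (hb : 0 < b) :
    Measure.map (dil3 a b) volume = ENNReal.ofReal ((a * b) ^ 2)⁻¹ • volume := by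
  have : dil3 a b = Prod.map (a * b * ·) (dil a b) := rfl
  rw [this, Measure.volume_eq_prod, ← Measure.map_prod_map _ _ (by fun_prop) (meas_dil a b),
    Real.map_volume_mul_left (by positivity), map_dil ha hb,
    Measure.prod_smul_left, Measure.prod_smul_right, smul_smul, ← ENNReal.ofReal_mul (by positivity)]
  congr 2
  rw [abs_of_pos (by positivity), pow_two, mul_inv (a * b) (a * b)]

theorem dil_dil_inv {a b : ℝ} (ha : 0 < a) (hb : 0 < b) (ξ) : dil a b (dil a⁻¹ b⁻¹ ξ) = ξ := by
  ext <;> simp [dil, ha.ne', hb.ne']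

theorem extOp_scale {a b : ℝ} (ha : 0 < a) (hb : 0 < b) {S : Set (ℝ × ℝ)} (hS : MeasurableSet S)
    (p : ℝ × ℝ × ℝ) :
    extOp (chi S) p = ((a * b : ℝ) : ℂ) * extOp (chi (dil a b ⁻¹' S)) (dil3 a b p) := by
  have key := integral_map (μ := volume) (φ := dil a b) (meas_dil a b).aemeasurable
    (f := fun ξ : ℝ × ℝ => Complex.exp (Complex.I * (p.1 * ξ.1 * ξ.2 + p.2.1 * ξ.1 + p.2.2 * ξ.2 : ℝ)) * chi S ξ)
    (by
      have h1 : StronglyMeasurable (chi S) := stronglyMeasurable_const.indicator hS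
      refine StronglyMeasurable.aestronglyMeasurable (StronglyMeasurable.mul ?_ h1)
      apply Continuous.stronglyMeasurable
      fun_prop)
  rw [map_dil ha hb, integral_smul_measure] at key
  unfold extOp
  have e : (∫ (x : ℝ × ℝ), Complex.exp (Complex.I *
      ((dil3 a b p).1 * x.1 * x.2 + (dil3 a b p).2.1 * x.1 + (dil3 a b p).2.2 * x.2 : ℝ)) *
        chi (dil a b ⁻¹' S) x) = ∫ (x : ℝ × ℝ),
      Complex.exp (Complex.I * (p.1 * (dil a b x).1 * (dil a b x).2 + p.2.1 * (dil a b x).1 + p.2.2 * (dil a b x).2 : ℝ)) *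
        chi S (dil a b x) := by
    congr 1
    ext x
    have h1 : chi (dil a b ⁻¹' S) x = chi S (dil a b x) := rfl
    rw [h1]
    congr 4
    simp only [dil3, dil]
    ring
  rw [e, ← key, ENNReal.toReal_ofReal (by positivity), Complex.real_smul, ← mul_assoc]
  rw [← Complex.ofReal_mul, mul_inv_cancel₀ (by positivity)]
  simp

theorem volume_dil_preimage {a b : ℝ} (ha : 0 < a) (hb : 0 < b) {S : Set (ℝ × ℝ)}
    (hS : MeasurableSet S) :
    volume (dil a b ⁻¹' S) = ENNReal.ofReal (a * b)⁻¹ * volume S := by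
  rw [← Measure.map_apply (meas_dil a b) hS, map_dil ha hb]; rfl

theorem volume_dil3_preimage {a b : ℝ} (ha : 0 < a) (hb : 0 < b) {S : Set (ℝ × ℝ × ℝ)}
    (hS : MeasurableSet S) :
    volume (dil3 a b ⁻¹' S) = ENNReal.ofReal ((a * b) ^ 2)⁻¹ * volume S := by
  rw [← Measure.map_apply (meas_dil3 a b) hS, map_dil3 ha hb]; rfl

theorem lintegral_dil3 {a b : ℝ} (ha : 0 < a) (hb : 0 < b) {F : ℝ × ℝ × ℝ → ℝ≥0∞}
    (hF : Measurable F) :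
    ∫⁻ p, F (dil3 a b p) = ENNReal.ofReal ((a * b) ^ 2)⁻¹ * ∫⁻ p, F p := by
  rw [← lintegral_map hF (meas_dil3 a b), map_dil3 ha hb, lintegral_smul_measure]; rfl

theorem eLpNorm_dil3 {a b s : ℝ} (ha : 0 < a) (hb : 0 < b) (hs : 0 < s) {F : ℝ × ℝ × ℝ → ℂ}
    (hF : StronglyMeasurable F) :
    eLpNorm (fun p => F (dil3 a b p)) (ENNReal.ofReal s) volume =
      ENNReal.ofReal (((a * b) ^ 2)⁻¹ ^ (1 / s)) * eLpNorm F (ENNReal.ofReal s) volume := by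
  have h := eLpNorm_map_measure (μ := volume) (f := dil3 a b) (g := F) (p := ENNReal.ofReal s)
    hF.aestronglyMeasurable (meas_dil3 a b).aemeasurable
  have e : (fun p => F (dil3 a b p)) = F ∘ dil3 a b := rfl
  rw [e, ← h, map_dil3 ha hb, eLpNorm_smul_measure_of_ne_zero, smul_eq_mul]
  · congr 1
    rw [one_div, ENNReal.toReal_inv, ENNReal.toReal_ofReal hs.le, ENNReal.ofReal_rpow_of_pos (by positivity), one_div]
  · rw [ENNReal.ofReal_ne_zero_iff]; positivity

theorem chi_norm_le {r ρ : ℝ} (hρ : ρ = max r 1) {S : Set (ℝ × ℝ)} (hv : volume S ≤ 1) :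
    eLpNorm (chi S) (ENNReal.ofReal r) volume ≤ volume S ^ (1 / ρ) := by
  rcases le_or_gt r 0 with h | h
  · rw [ENNReal.ofReal_of_nonpos h]; simp
  · refine (eLpNorm_indicator_const_le _ _).trans ?_
    rw [ENNReal.toReal_ofReal h.le]
    simp only [enorm_one, one_mul]
    apply ENNReal.rpow_le_rpow_of_exponent_ge hv
    exact one_div_le_one_div_of_le h (by rw [hρ]; exact le_max_left _ _)

theorem vol_rect (u v h k : ℝ) (hh : 0 ≤ h) :
    volume (Icc u (u + h) ×ˢ Icc v (v + k)) = ENNReal.ofReal (h * k) := by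
  rw [Measure.volume_eq_prod, Measure.prod_prod, Real.volume_Icc, Real.volume_Icc,
    ENNReal.ofReal_mul hh]
  congr 2 <;> ring

theorem bil_unit {s r A ρ : ℝ} (hBH : BH s r A) (hρ : ρ = max r 1) {a a' b b' : ℝ}
    (h1 : |a - b| = 2) (h2 : |a' - b'| = 2) {S S' : Set (ℝ × ℝ)}
    (hS : S ⊆ unitSq a a') (hS' : S' ⊆ unitSq b b') :
    eLpNorm (fun p => extOp (chi S) p * extOp (chi S') p) (ENNReal.ofReal s) volume ≤
      ENNReal.ofReal A * volume S ^ (1 / ρ) * volume S' ^ (1 / ρ) := by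
  have v1 : volume S ≤ 1 := by
    refine (measure_mono hS).trans ?_
    rw [unitSq, vol_rect _ _ _ _ (by norm_num)]; simp
  have v2 : volume S' ≤ 1 := by
    refine (measure_mono hS').trans ?_
    rw [unitSq, vol_rect _ _ _ _ (by norm_num)]; simp
  refine (hBH a a' b b' h1.ge (by rw [h1]; norm_num) h2.ge (by rw [h2]; norm_num) (chi S) (chi S')
    ?_ ?_).trans ?_
  · exact (Set.support_indicator_subset).trans hS
  · exact (Set.support_indicator_subset).trans hS'
  · gcongr
    · exact chi_norm_le hρ v1
    · exact chi_norm_le hρ v2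

theorem dil_preimage_rect {l l' a a' : ℝ} (hl : 0 < l) (hl' : 0 < l') {S : Set (ℝ × ℝ)}
    (hS : S ⊆ Icc a (a + l) ×ˢ Icc a' (a' + l')) :
    dil l l' ⁻¹' S ⊆ unitSq (a / l) (a' / l') := by
  intro ξ hξ
  have := hS hξ
  simp only [dil, mem_prod, mem_Icc] at this
  obtain ⟨⟨h1, h2⟩, h3, h4⟩ := this
  refine ⟨⟨?_, ?_⟩, ?_, ?_⟩
  · rw [div_le_iff₀ hl]; linarith
  · rw [← sub_le_iff_le_add, le_div_iff₀ hl]; linarith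
  · rw [div_le_iff₀ hl']; linarith
  · rw [← sub_le_iff_le_add, le_div_iff₀ hl']; linarith

theorem bil_corner {s r A ρ : ℝ} (hs : 0 < s) (hBH : BH s r A) (hρ : ρ = max r 1)
    {a a' b b' l l' : ℝ} (hl : 0 < l) (hl' : 0 < l')
    (h1 : |a - b| = 2 * l) (h2 : |a' - b'| = 2 * l') {S S' : Set (ℝ × ℝ)}
    (mS : MeasurableSet S) (mS' : MeasurableSet S')
    (hS : S ⊆ Icc a (a + l) ×ˢ Icc a' (a' + l')) (hS' : S' ⊆ Icc b (b + l) ×ˢ Icc b' (b' + l')) :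
    eLpNorm (fun p => extOp (chi S) p * extOp (chi S') p) (ENNReal.ofReal s) volume ≤
      ENNReal.ofReal A * ENNReal.ofReal ((l * l') ^ (-(2 / ρ - 2 * (1 - 1 / s)))) *
        volume S ^ (1 / ρ) * volume S' ^ (1 / ρ) := by
  have hρ0 : 0 < ρ := by rw [hρ]; exact lt_of_lt_of_le one_pos (le_max_right _ _)
  have m0 : 0 < l * l' := by positivity
  have mT : MeasurableSet (dil l l' ⁻¹' S) := meas_dil _ _ mS
  have mT' : MeasurableSet (dil l l' ⁻¹' S') := meas_dil _ _ mS'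
  have e : (fun p => extOp (chi S) p * extOp (chi S') p) = (((l * l') ^ 2 : ℝ) : ℂ) •
      (fun p => (fun q => extOp (chi (dil l l' ⁻¹' S)) q * extOp (chi (dil l l' ⁻¹' S')) q)
        (dil3 l l' p)) := by
    ext p
    simp only [Pi.smul_apply, smul_eq_mul]
    rw [extOp_scale hl hl' mS, extOp_scale hl hl' mS']
    push_cast
    ring
  rw [e, eLpNorm_const_smul, eLpNorm_dil3 hl hl' hs (F := fun q => extOp (chi (dil l l' ⁻¹' S)) q * extOp (chi (dil l l' ⁻¹' S')) q)
      ((sm_extOp mT).mul (sm_extOp mT'))]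
  have B := bil_unit hBH hρ (a := a / l) (b := b / l) (a' := a' / l') (b' := b' / l') (by
      rw [← sub_div, abs_div, h1, abs_of_pos hl]; field_simp) (by
      rw [← sub_div, abs_div, h2, abs_of_pos hl']; field_simp)
      (dil_preimage_rect hl hl' hS) (dil_preimage_rect hl hl' hS')
  rw [volume_dil_preimage hl hl' mS, volume_dil_preimage hl hl' mS',
    ENNReal.mul_rpow_of_nonneg _ _ (by positivity), ENNReal.mul_rpow_of_nonneg _ _ (by positivity),
    ENNReal.ofReal_rpow_of_pos (by positivity)] at B
  have c : (l * l') ^ (-(2 / ρ - 2 * (1 - 1 / s))) =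
      (l * l') ^ 2 * (((l * l') ^ 2)⁻¹ ^ (1 / s)) * ((l * l')⁻¹ ^ (1 / ρ)) * ((l * l')⁻¹ ^ (1 / ρ)) := by
    rw [← Real.rpow_natCast (l * l') 2, ← Real.rpow_neg m0.le, ← Real.rpow_mul m0.le,
      ← Real.rpow_neg_one (l * l'), ← Real.rpow_mul m0.le, ← Real.rpow_add m0, ← Real.rpow_add m0, ← Real.rpow_add m0]
    congr 1
    push_cast
    ring
  have n1 : ‖(((l * l') ^ 2 : ℝ) : ℂ)‖ₑ = ENNReal.ofReal ((l * l') ^ 2) := by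
    rw [← ofReal_norm, Complex.norm_real, Real.norm_of_nonneg (by positivity)]
  rw [n1, c, ENNReal.ofReal_mul (by positivity), ENNReal.ofReal_mul (by positivity),
    ENNReal.ofReal_mul (by positivity)]
  refine (mul_le_mul_right (mul_le_mul_right B _) _).trans (le_of_eq ?_)
  ring

/-- one-dimensional geometric adjustment -/
theorem adjust {u v h : ℝ} (hh : 0 < h) (huv : 2 * h ≤ |u - v|) :
    ∃ a b l, h ≤ l ∧ |a - b| = 2 * l ∧ Icc u (u + h) ⊆ Icc a (a + l) ∧
      Icc v (v + h) ⊆ Icc b (b + l) := by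
  rcases le_total u v with H | H
  · rw [abs_sub_comm, abs_of_nonneg (by linarith)] at huv
    refine ⟨u + h - (v - (u + h)), v, v - (u + h), by linarith, ?_, Icc_subset_Icc (by linarith) (by linarith), Icc_subset_Icc (by linarith) (by linarith)⟩
    rw [abs_sub_comm, abs_of_nonneg (by linarith)]; ring
  · rw [abs_of_nonneg (by linarith)] at huv
    refine ⟨u, v + h - (u - (v + h)), u - (v + h), by linarith, ?_, Icc_subset_Icc (by linarith) (by linarith), Icc_subset_Icc (by linarith) (by linarith)⟩
    rw [abs_of_nonneg (by linarith)]; ring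

theorem bil {s r A ρ : ℝ} (hs : 0 < s) (hBH : BH s r A) (hρ : ρ = max r 1)
    (hσ : 0 < 2 / ρ - 2 * (1 - 1 / s))
    {u u' v v' h h' : ℝ} (hh : 0 < h) (hh' : 0 < h')
    (h1 : 2 * h ≤ |u - v|) (h2 : 2 * h' ≤ |u' - v'|) {S S' : Set (ℝ × ℝ)}
    (mS : MeasurableSet S) (mS' : MeasurableSet S')
    (hS : S ⊆ Icc u (u + h) ×ˢ Icc u' (u' + h')) (hS' : S' ⊆ Icc v (v + h) ×ˢ Icc v' (v' + h')) :
    eLpNorm (fun p => extOp (chi S) p * extOp (chi S') p) (ENNReal.ofReal s) volume ≤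
      ENNReal.ofReal A * ENNReal.ofReal ((h * h') ^ (-(2 / ρ - 2 * (1 - 1 / s)))) *
        volume S ^ (1 / ρ) * volume S' ^ (1 / ρ) := by
  obtain ⟨a, b, l, hl, e1, i1, i2⟩ := adjust hh h1
  obtain ⟨a', b', l', hl', e1', i1', i2'⟩ := adjust hh' h2
  refine (bil_corner hs hBH hρ (hh.trans_le hl) (hh'.trans_le hl') e1 e1' mS mS'
    (hS.trans (prod_mono i1 i1')) (hS'.trans (prod_mono i2 i2'))).trans ?_
  gcongr _ * ?_ * _ * _
  apply ENNReal.ofReal_le_ofReal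
  apply Real.rpow_le_rpow_of_nonpos (by positivity) _ (by linarith)
  gcongr
  exact hh.le.trans hl

theorem sum_extOp {S : Set (ℝ × ℝ)} (hS : MeasurableSet S) (hf : volume S ≠ ∞)
    {φ : ℝ × ℝ → ℤ} (hφ : Measurable φ) (T : Finset ℤ) (hT : ∀ ξ ∈ S, φ ξ ∈ T) (p : ℝ × ℝ × ℝ) :
    extOp (chi S) p = ∑ i ∈ T, extOp (chi (S ∩ φ ⁻¹' {i})) p := by
  unfold extOp
  rw [← integral_finsetSum]
  · congr 1
    ext ξ
    rw [← Finset.mul_sum]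
    congr 1
    unfold chi
    by_cases h1 : ξ ∈ S
    · rw [Finset.sum_eq_single (φ ξ)]
      · simp [h1]
      · intro b _ hb
        simp [hb.symm]
      · intro h; exact absurd (hT ξ h1) h
    · simp [h1]
  · intro i _
    exact int_extOp (hS.inter (hφ (measurableSet_singleton i)))
      (measure_ne_top_of_subset inter_subset_left hf) p

theorem pow4 {q : ℝ} (hq : 0 ≤ q) (x y z w : ℝ≥0∞) :
    (x + y + z + w) ^ q ≤ 4 ^ q * (x ^ q + y ^ q + z ^ q + w ^ q) := by
  have key : ∀ m : ℝ≥0∞, x ≤ m → y ≤ m → z ≤ m → w ≤ m →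
      m ^ q ≤ x ^ q + y ^ q + z ^ q + w ^ q →
      (x + y + z + w) ^ q ≤ 4 ^ q * (x ^ q + y ^ q + z ^ q + w ^ q) := by
    intro m h1 h2 h3 h4 h5
    have : x + y + z + w ≤ 4 * m := by
      calc _ ≤ m + m + m + m := by gcongr
        _ = 4 * m := by ring
    calc _ ≤ (4 * m) ^ q := by gcongr
      _ = 4 ^ q * m ^ q := ENNReal.mul_rpow_of_nonneg _ _ hq
      _ ≤ _ := by gcongr
  rcases le_total x y with h1 | h1 <;> rcases le_total z w with h2 | h2
  · rcases le_total y w with h3 | h3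
    · exact key w (h1.trans h3) h3 h2 le_rfl le_add_self
    · exact key y h1 le_rfl (h2.trans h3) h3 (le_add_right (le_add_right le_add_self))
  · rcases le_total y z with h3 | h3
    · exact key z (h1.trans h3) h3 le_rfl h2 (le_add_right le_add_self)
    · exact key y h1 le_rfl h3 (h2.trans h3) (le_add_right (le_add_right le_add_self))
  · rcases le_total x w with h3 | h3
    · exact key w h3 (h1.trans h3) h2 le_rfl le_add_self
    · exact key x le_rfl h1 (h2.trans h3) h3 (le_add_right (le_add_right (le_add_right le_rfl)))
  · rcases le_total x z with h3 | h3
    · exact key z h3 (h1.trans h3) le_rfl h2 (le_add_right le_add_self)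
    · exact key x le_rfl h1 h3 (h2.trans h3) (le_add_right (le_add_right (le_add_right le_rfl)))

/-- far pairs of grid cells -/
def farPairs (T : Finset ℤ) : Finset ((ℤ × ℤ) × (ℤ × ℤ)) :=
  ((T ×ˢ T) ×ˢ (T ×ˢ T)).filter (fun x => 2 ≤ |x.1.1 - x.2.1| ∧ 2 ≤ |x.1.2 - x.2.2|)

theorem le_root {ι : Type*} {q : ℝ} (hq : 0 < q) (T : Finset ι) (f : ι → ℝ≥0∞) {i : ι} (hi : i ∈ T) :
    f i ≤ (∑ i ∈ T, f i ^ q) ^ (1 / q) := by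
  calc f i = (f i ^ q) ^ (1 / q) := by rw [← ENNReal.rpow_mul, mul_one_div_cancel hq.ne', ENNReal.rpow_one]
    _ ≤ _ := by
      apply ENNReal.rpow_le_rpow _ (by positivity)
      exact Finset.single_le_sum (f := fun i => f i ^ q) (fun _ _ => zero_le) hi

theorem root_pow {q : ℝ} (hq : 0 < q) (x : ℝ≥0∞) : (x ^ (1 / q)) ^ q = x := by
  rw [← ENNReal.rpow_mul, one_div_mul_cancel hq.ne', ENNReal.rpow_one]

theorem near_card (T : Finset ℤ) (i₀ : ℤ) : (T.filter (fun i => |i - i₀| < 2)).card ≤ 3 := by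
  have : T.filter (fun i => |i - i₀| < 2) ⊆ Finset.Icc (i₀ - 1) (i₀ + 1) := by
    intro i hi
    rw [Finset.mem_filter, abs_lt] at hi
    rw [Finset.mem_Icc]; omega
  refine (Finset.card_le_card this).trans ?_
  rw [Int.card_Icc]; omega

theorem enorm_sum_le_card {ι : Type*} (T : Finset ι) (f : ι → ℂ) (B : ℝ≥0∞) (N : ℕ) (hN : T.card ≤ N)
    (h : ∀ i ∈ T, ‖f i‖ₑ ≤ B) : ‖∑ i ∈ T, f i‖ₑ ≤ N * B := by
  refine (enorm_sum_le _ _).trans ?_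
  refine (Finset.sum_le_card_nsmul _ _ _ h).trans ?_
  rw [nsmul_eq_mul]
  gcongr

theorem broad_narrow {q : ℝ} (hq : 0 < q) (T : Finset ℤ) (e : ℤ → ℤ → ℂ) :
    ‖∑ i ∈ T, ∑ j ∈ T, e i j‖ₑ ^ q ≤
      36 ^ q * ((∑ i ∈ T, ‖∑ j ∈ T, e i j‖ₑ ^ q) + (∑ j ∈ T, ‖∑ i ∈ T, e i j‖ₑ ^ q) +
        (∑ x ∈ T ×ˢ T, ‖e x.1 x.2‖ₑ ^ q)) +
      4 ^ q * ((T.card * T.card : ℕ) : ℝ≥0∞) ^ q *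
        ∑ x ∈ farPairs T, ‖e x.1.1 x.1.2 * e x.2.1 x.2.2‖ₑ ^ (q / 2) := by
  rcases T.eq_empty_or_nonempty with rfl | hT
  · simp [hq]
  obtain ⟨⟨i₀, j₀⟩, h0, hmax⟩ := Finset.exists_max_image (T ×ˢ T) (fun x => ‖e x.1 x.2‖ₑ) (hT.product hT)
  set N1 := T.filter (fun i => |i - i₀| < 2) with hN1
  set F1 := T.filter (fun i => ¬ |i - i₀| < 2) with hF1
  set N2 := T.filter (fun i => |i - j₀| < 2) with hN2
  set F2 := T.filter (fun i => ¬ |i - j₀| < 2) with hF2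
  have s1 : ∀ f : ℤ → ℂ, ∑ i ∈ T, f i = ∑ i ∈ N1, f i + ∑ i ∈ F1, f i := fun f =>
    (Finset.sum_filter_add_sum_filter_not T _ f).symm
  have s2 : ∀ f : ℤ → ℂ, ∑ i ∈ T, f i = ∑ i ∈ N2, f i + ∑ i ∈ F2, f i := fun f =>
    (Finset.sum_filter_add_sum_filter_not T _ f).symm
  have id1 : ∑ i ∈ T, ∑ j ∈ T, e i j = (∑ i ∈ N1, ∑ j ∈ T, e i j) + (∑ j ∈ N2, ∑ i ∈ T, e i j)
      + (-(∑ x ∈ N1 ×ˢ N2, e x.1 x.2)) + ∑ x ∈ F1 ×ˢ F2, e x.1 x.2 := by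
    rw [s1 (fun i => ∑ j ∈ T, e i j), Finset.sum_product, Finset.sum_product]
    have a1 : ∑ i ∈ F1, ∑ j ∈ T, e i j = ∑ i ∈ F1, ∑ j ∈ N2, e i j + ∑ i ∈ F1, ∑ j ∈ F2, e i j := by
      rw [← Finset.sum_add_distrib]
      exact Finset.sum_congr rfl fun i _ => s2 _
    have a2 : ∑ j ∈ N2, ∑ i ∈ T, e i j = ∑ i ∈ N1, ∑ j ∈ N2, e i j + ∑ i ∈ F1, ∑ j ∈ N2, e i j := by
      rw [Finset.sum_comm (s := N1), Finset.sum_comm (s := F1), ← Finset.sum_add_distrib]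
      exact Finset.sum_congr rfl fun i _ => s1 _
    rw [a1, a2]; ring
  set v := (∑ i ∈ T, ‖∑ j ∈ T, e i j‖ₑ ^ q) ^ (1 / q) with hv
  set h := (∑ j ∈ T, ‖∑ i ∈ T, e i j‖ₑ ^ q) ^ (1 / q) with hh
  set m := (∑ x ∈ T ×ˢ T, ‖e x.1 x.2‖ₑ ^ q) ^ (1 / q) with hm
  set β := (∑ x ∈ farPairs T, ‖e x.1.1 x.1.2 * e x.2.1 x.2.2‖ₑ ^ (q / 2)) ^ (1 / q) with hβ
  have b1 : ‖∑ i ∈ N1, ∑ j ∈ T, e i j‖ₑ ≤ 9 * v := by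
    refine (enorm_sum_le_card N1 _ v 3 (near_card _ _) fun i hi => ?_).trans ?_
    · exact le_root hq T (fun i => ‖∑ j ∈ T, e i j‖ₑ) (Finset.mem_filter.1 hi).1
    · gcongr; norm_num
  have b2 : ‖∑ j ∈ N2, ∑ i ∈ T, e i j‖ₑ ≤ 9 * h := by
    refine (enorm_sum_le_card N2 _ h 3 (near_card _ _) fun i hi => ?_).trans ?_
    · exact le_root hq T (fun j => ‖∑ i ∈ T, e i j‖ₑ) (Finset.mem_filter.1 hi).1
    · gcongr; norm_num
  have b3 : ‖-∑ x ∈ N1 ×ˢ N2, e x.1 x.2‖ₑ ≤ 9 * m := by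
    rw [enorm_neg]
    refine (enorm_sum_le_card _ _ m 9 ?_ fun i hi => ?_).trans ?_
    · rw [Finset.card_product]; exact Nat.mul_le_mul (near_card T i₀) (near_card T j₀)
    · rw [Finset.mem_product] at hi
      exact le_root hq (T ×ˢ T) (fun x => ‖e x.1 x.2‖ₑ) (Finset.mem_product.2
        ⟨(Finset.mem_filter.1 hi.1).1, (Finset.mem_filter.1 hi.2).1⟩)
    · norm_num
  have b4 : ‖∑ x ∈ F1 ×ˢ F2, e x.1 x.2‖ₑ ≤ ((T.card * T.card : ℕ) : ℝ≥0∞) * β := by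
    refine enorm_sum_le_card _ _ β _ ?_ fun x hx => ?_
    · rw [Finset.card_product]
      exact Nat.mul_le_mul (Finset.card_filter_le _ _) (Finset.card_filter_le _ _)
    · rw [Finset.mem_product] at hx
      have h1 := Finset.mem_filter.1 hx.1
      have h2 := Finset.mem_filter.1 hx.2
      have hxT : x ∈ T ×ˢ T := Finset.mem_product.2 ⟨h1.1, h2.1⟩
      have hmem : (x, (i₀, j₀)) ∈ farPairs T := by
        unfold farPairs
        rw [Finset.mem_filter]
        exact ⟨Finset.mem_product.2 ⟨hxT, h0⟩, not_lt.1 h1.2, not_lt.1 h2.2⟩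
      have h3 := Finset.single_le_sum (f := fun x : (ℤ × ℤ) × (ℤ × ℤ) =>
        ‖e x.1.1 x.1.2 * e x.2.1 x.2.2‖ₑ ^ (q / 2)) (fun _ _ => zero_le) hmem
      have h4 : ‖e x.1 x.2‖ₑ ^ q ≤ ‖e x.1 x.2 * e i₀ j₀‖ₑ ^ (q / 2) := by
        have : q = 2 * (q / 2) := by ring
        conv_lhs => rw [this, ENNReal.rpow_mul]
        apply ENNReal.rpow_le_rpow _ (by positivity)
        rw [enorm_mul, ENNReal.rpow_two, pow_two]
        gcongr
        exact hmax x hxT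
      have h5 := h4.trans h3
      calc ‖e x.1 x.2‖ₑ = (‖e x.1 x.2‖ₑ ^ q) ^ (1 / q) := by
            rw [← ENNReal.rpow_mul, mul_one_div_cancel hq.ne', ENNReal.rpow_one]
        _ ≤ β := ENNReal.rpow_le_rpow h5 (by positivity)
  have tot : ‖∑ i ∈ T, ∑ j ∈ T, e i j‖ₑ ≤ 9 * v + 9 * h + 9 * m + ((T.card * T.card : ℕ) : ℝ≥0∞) * β := by
    rw [id1]
    refine (enorm_add_le _ _).trans (add_le_add ((enorm_add_le _ _).trans (add_le_add
      ((enorm_add_le _ _).trans (add_le_add b1 b2)) b3)) b4)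
  refine (ENNReal.rpow_le_rpow tot hq.le).trans ((pow4 hq.le _ _ _ _).trans (le_of_eq ?_))
  simp only [ENNReal.mul_rpow_of_nonneg _ _ hq.le]
  rw [hv, hh, hm, hβ, root_pow hq, root_pow hq, root_pow hq, root_pow hq]
  have : (36 : ℝ≥0∞) ^ q = 4 ^ q * 9 ^ q := by
    rw [← ENNReal.mul_rpow_of_nonneg _ _ hq.le]; norm_num
  rw [this]
  ring

/-- values of localized norms of extensions of subsets of unit squares -/
def linSet (q : ℝ) (M : ℝ≥0∞) : Set ℝ≥0∞ :=
  {z | ∃ (a b : ℝ) (S : Set (ℝ × ℝ)) (X : Set (ℝ × ℝ × ℝ)), MeasurableSet S ∧ S ⊆ unitSq a b ∧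
    MeasurableSet X ∧ volume X ≤ M ∧ z = ∫⁻ p in X, ‖extOp (chi S) p‖ₑ ^ q}

theorem linSet_le {q : ℝ} (hq : 0 ≤ q) (M : ℝ≥0∞) : sSup (linSet q M) ≤ M := by
  apply sSup_le
  rintro z ⟨a, b, S, X, mS, hS, mX, hX, rfl⟩
  calc ∫⁻ p in X, ‖extOp (chi S) p‖ₑ ^ q ≤ ∫⁻ p in X, 1 := by
        apply lintegral_mono
        intro p
        have : ‖extOp (chi S) p‖ₑ ≤ 1 := by
          refine (enorm_extOp_le mS p).trans ((measure_mono hS).trans ?_)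
          rw [unitSq, vol_rect _ _ _ _ (by norm_num)]; simp
        calc ‖extOp (chi S) p‖ₑ ^ q ≤ 1 ^ q := by gcongr
          _ = 1 := ENNReal.one_rpow _
    _ = volume X := by simp
    _ ≤ M := hX

theorem lin_scale {q : ℝ} (hq : 0 ≤ q) {M : ℝ≥0∞} {u v w h : ℝ} (hw : 0 < w) (hh : 0 < h)
    (hwh : w * h ≤ 1) {S : Set (ℝ × ℝ)} (mS : MeasurableSet S)
    (hS : S ⊆ Icc u (u + w) ×ˢ Icc v (v + h)) {X : Set (ℝ × ℝ × ℝ)} (mX : MeasurableSet X)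
    (hX : volume X ≤ M) :
    ∫⁻ p in X, ‖extOp (chi S) p‖ₑ ^ q ≤ ENNReal.ofReal ((w * h) ^ (q - 2)) * sSup (linSet q M) := by
  have m0 : 0 < w * h := by positivity
  set S' := dil w h ⁻¹' S with hS'
  have mS' : MeasurableSet S' := meas_dil _ _ mS
  set X' := dil3 w⁻¹ h⁻¹ ⁻¹' X with hX'
  have mX' : MeasurableSet X' := meas_dil3 _ _ mX
  have vX' : volume X' ≤ M := by
    rw [hX', volume_dil3_preimage (by positivity) (by positivity) mX]
    refine le_trans ?_ hX
    calc _ ≤ ENNReal.ofReal 1 * volume X := by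
          gcongr
          rw [← mul_inv, inv_pow, inv_inv]
          exact pow_le_one₀ m0.le hwh
      _ = volume X := by simp
  have mem : (∫⁻ p in X', ‖extOp (chi S') p‖ₑ ^ q) ≤ sSup (linSet q M) :=
    le_sSup ⟨u / w, v / h, S', X', mS', dil_preimage_rect hw hh hS, mX', vX', rfl⟩
  refine le_trans (le_of_eq ?_) (mul_le_mul_right mem _)
  have mG : Measurable (X'.indicator (fun p => ‖extOp (chi S') p‖ₑ ^ q)) :=
    ((sm_extOp mS').enorm.pow_const q).indicator mX'
  rw [← lintegral_indicator mX, ← lintegral_indicator mX']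
  have e := lintegral_dil3 hw hh mG
  have c : ENNReal.ofReal ((w * h) ^ (q - 2)) = ENNReal.ofReal ((w * h) ^ q) * ENNReal.ofReal ((w * h) ^ 2)⁻¹ := by
    rw [← ENNReal.ofReal_mul (by positivity), Real.rpow_sub m0]
    simp [div_eq_mul_inv]
  rw [c, mul_assoc, ← e, ← lintegral_const_mul _ (f := fun p => X'.indicator (fun p => ‖extOp (chi S') p‖ₑ ^ q) (dil3 w h p)) (mG.comp (meas_dil3 w h))]
  congr 1
  ext p
  have hmem : dil3 w h p ∈ X' ↔ p ∈ X := by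
    rw [hX', mem_preimage]
    have : dil3 w⁻¹ h⁻¹ (dil3 w h p) = p := by
      unfold dil3
      ext <;> simp <;> field_simp
    rw [this]
  by_cases hp : p ∈ X
  · rw [indicator_of_mem hp, indicator_of_mem (hmem.2 hp), extOp_scale hw hh mS, enorm_mul,
      ENNReal.mul_rpow_of_nonneg _ _ hq]
    congr 1
    rw [← ofReal_norm, Complex.norm_real, Real.norm_of_nonneg m0.le, ENNReal.ofReal_rpow_of_pos m0]
  · rw [indicator_of_notMem hp, indicator_of_notMem (fun h => hp (hmem.1 h)), mul_zero]

theorem floor_strip {a x : ℝ} {n : ℕ} (hn : 0 < n) {i : ℤ} (h : ⌊(x - a) * n⌋ = i) :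
    x ∈ Icc (a + i * (1 / n : ℝ)) (a + i * (1 / n : ℝ) + 1 / n) := by
  have hn' : (0 : ℝ) < n := by exact_mod_cast hn
  rw [Int.floor_eq_iff] at h
  have e : x = a + ((x - a) * n) * (1 / n : ℝ) := by field_simp; ring
  have p : (0 : ℝ) < 1 / n := by positivity
  constructor
  · rw [e]; gcongr; exact h.1
  · rw [e, add_assoc]
    gcongr
    nlinarith [h.2]

theorem floor_mem {a x : ℝ} {n : ℕ} (hx : x ∈ Icc a (a + 1)) :
    ⌊(x - a) * n⌋ ∈ Finset.Icc (0 : ℤ) n := by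
  rw [Finset.mem_Icc]
  have hn' : (0 : ℝ) ≤ n := by positivity
  constructor
  · apply Int.floor_nonneg.2
    exact mul_nonneg (by linarith [hx.1]) hn'
  · have : (x - a) * n ≤ n := by
      nlinarith [hx.2]
    have := Int.floor_le_floor this
    simpa using this

theorem lint4 {μ : Measure (ℝ × ℝ × ℝ)} (c d : ℝ≥0∞) {F1 F2 F3 F4 : ℝ × ℝ × ℝ → ℝ≥0∞}
    (m1 : Measurable F1) (m2 : Measurable F2) (m3 : Measurable F3) (m4 : Measurable F4) :
    ∫⁻ p, (c * (F1 p + F2 p + F3 p) + d * F4 p) ∂μ =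
      c * (∫⁻ p, F1 p ∂μ + ∫⁻ p, F2 p ∂μ + ∫⁻ p, F3 p ∂μ) + d * ∫⁻ p, F4 p ∂μ := by
  have m12 : Measurable fun p => F1 p + F2 p := m1.add m2
  have m123 : Measurable fun p => F1 p + F2 p + F3 p := m12.add m3
  rw [lintegral_add_left (m123.const_mul c), lintegral_const_mul _ m123,
    lintegral_const_mul _ m4, lintegral_add_left m12, lintegral_add_left m1]

theorem lin_step {s r A ρ : ℝ} (hs : 0 < s) (hBH : BH s r A) (hρ : ρ = max r 1)
    (hσ : 0 < 2 / ρ - 2 * (1 - 1 / s)) {n : ℕ} (hn : 0 < n) {M : ℝ≥0∞} :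
    sSup (linSet (2 * s) M) ≤ 36 ^ (2 * s) *
      (2 * ENNReal.ofReal ((n + 1) * (1 / n : ℝ) ^ (2 * s - 2)) +
        ENNReal.ofReal (((n + 1) * (1 / n : ℝ) ^ (2 * s - 2)) ^ 2)) * sSup (linSet (2 * s) M) +
      4 ^ (2 * s) * (((n + 1) * (n + 1) : ℕ) : ℝ≥0∞) ^ (2 * s) *
        ((farPairs (Finset.Icc 0 (n : ℤ))).card *
        (ENNReal.ofReal A * ENNReal.ofReal ((1 / n * (1 / n) : ℝ) ^ (-(2 / ρ - 2 * (1 - 1 / s))))) ^ s) := by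
  have hρ0 : 0 < ρ := by rw [hρ]; exact lt_of_lt_of_le one_pos (le_max_right _ _)
  have hn' : (0 : ℝ) < n := by exact_mod_cast hn
  have hn1 : (1 / n : ℝ) ≤ 1 := by
    rw [div_le_one hn']; exact_mod_cast hn
  have q0 : 0 < 2 * s := by positivity
  set Q := sSup (linSet (2 * s) M) with hQ
  apply sSup_le
  rintro z ⟨a, b, S, X, mS, hS, mX, hX, rfl⟩
  set T := Finset.Icc (0 : ℤ) n with hT
  have cT : T.card = n + 1 := by rw [hT, Int.card_Icc]; omega
  let φ : ℝ × ℝ → ℤ := fun ξ => ⌊(ξ.1 - a) * n⌋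
  let ψ : ℝ × ℝ → ℤ := fun ξ => ⌊(ξ.2 - b) * n⌋
  have mφ : Measurable φ := Int.measurable_floor.comp (by fun_prop)
  have mψ : Measurable ψ := Int.measurable_floor.comp (by fun_prop)
  have fS : volume S ≠ ∞ := by
    refine measure_ne_top_of_subset hS ?_
    rw [unitSq, vol_rect _ _ _ _ (by norm_num)]; simp
  have mV : ∀ i, MeasurableSet (S ∩ φ ⁻¹' {i}) := fun i => mS.inter (mφ (measurableSet_singleton i))
  have mH : ∀ i, MeasurableSet (S ∩ ψ ⁻¹' {i}) := fun i => mS.inter (mψ (measurableSet_singleton i))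
  have mC : ∀ i j, MeasurableSet (S ∩ φ ⁻¹' {i} ∩ ψ ⁻¹' {j}) :=
    fun i j => (mV i).inter (mψ (measurableSet_singleton j))
  let e : ℝ × ℝ × ℝ → ℤ → ℤ → ℂ := fun p i j => extOp (chi (S ∩ φ ⁻¹' {i} ∩ ψ ⁻¹' {j})) p
  have eV : ∀ p i, ∑ j ∈ T, e p i j = extOp (chi (S ∩ φ ⁻¹' {i})) p := by
    intro p i
    exact (sum_extOp (mV i) (measure_ne_top_of_subset inter_subset_left fS) mψ T
      (fun ξ hξ => floor_mem (hS hξ.1).2) p).symm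
  have eH : ∀ p j, ∑ i ∈ T, e p i j = extOp (chi (S ∩ ψ ⁻¹' {j})) p := by
    intro p j
    rw [sum_extOp (mH j) (measure_ne_top_of_subset inter_subset_left fS) mφ T
      (fun ξ hξ => floor_mem (hS hξ.1).1) p]
    refine Finset.sum_congr rfl fun i _ => ?_
    simp only [e]
    rw [inter_right_comm]
  have eS : ∀ p, ∑ i ∈ T, ∑ j ∈ T, e p i j = extOp (chi S) p := by
    intro p
    rw [sum_extOp mS fS mφ T (fun ξ hξ => floor_mem (hS hξ).1) p]
    exact Finset.sum_congr rfl fun i _ => eV p i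
  have subV : ∀ i : ℤ, S ∩ φ ⁻¹' {i} ⊆ Icc (a + i * (1 / n : ℝ)) (a + i * (1 / n : ℝ) + 1 / n) ×ˢ Icc b (b + 1) :=
    fun i ξ hξ => ⟨floor_strip hn hξ.2, (hS hξ.1).2⟩
  have subH : ∀ j : ℤ, S ∩ ψ ⁻¹' {j} ⊆ Icc a (a + 1) ×ˢ Icc (b + j * (1 / n : ℝ)) (b + j * (1 / n : ℝ) + 1 / n) :=
    fun i ξ hξ => ⟨(hS hξ.1).1, floor_strip hn hξ.2⟩
  have subC : ∀ i j : ℤ, S ∩ φ ⁻¹' {i} ∩ ψ ⁻¹' {j} ⊆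
      Icc (a + i * (1 / n : ℝ)) (a + i * (1 / n : ℝ) + 1 / n) ×ˢ Icc (b + j * (1 / n : ℝ)) (b + j * (1 / n : ℝ) + 1 / n) :=
    fun i j ξ hξ => ⟨floor_strip hn hξ.1.2, floor_strip hn hξ.2⟩
  have iV : ∀ i, ∫⁻ p in X, ‖extOp (chi (S ∩ φ ⁻¹' {i})) p‖ₑ ^ (2 * s) ≤
      ENNReal.ofReal ((1 / n : ℝ) ^ (2 * s - 2)) * Q := by
    intro i
    have := lin_scale q0.le (by positivity) one_pos (by simpa using hn1) (mV i) (subV i) mX hX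
    simpa only [mul_one] using this
  have iH : ∀ i, ∫⁻ p in X, ‖extOp (chi (S ∩ ψ ⁻¹' {i})) p‖ₑ ^ (2 * s) ≤
      ENNReal.ofReal ((1 / n : ℝ) ^ (2 * s - 2)) * Q := by
    intro i
    have := lin_scale q0.le one_pos (by positivity) (by simpa using hn1) (mH i) (subH i) mX hX
    simpa only [one_mul] using this
  have iC : ∀ i j, ∫⁻ p in X, ‖e p i j‖ₑ ^ (2 * s) ≤
      ENNReal.ofReal (((1 / n : ℝ) ^ (2 * s - 2)) ^ 2) * Q := by
    intro i j
    have := lin_scale q0.le (by positivity) (by positivity) (mul_le_one₀ hn1 (by positivity) hn1) (mC i j) (subC i j) mX hX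
    rw [Real.mul_rpow (by positivity) (by positivity), ← pow_two] at this
    exact this
  set B := ENNReal.ofReal A * ENNReal.ofReal ((1 / n * (1 / n) : ℝ) ^ (-(2 / ρ - 2 * (1 - 1 / s)))) with hB
  have iB : ∀ x ∈ farPairs T, ∫⁻ p in X, ‖e p x.1.1 x.1.2 * e p x.2.1 x.2.2‖ₑ ^ s ≤ B ^ s := by
    intro x hx
    have hx' := (Finset.mem_filter.1 hx).2
    have sep : ∀ (c : ℝ) (i j : ℤ), 2 ≤ |i - j| →
        2 * (1 / n : ℝ) ≤ |(c + i * (1 / n : ℝ)) - (c + j * (1 / n : ℝ))| := by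
      intro c i j hij
      have : (c + i * (1 / n : ℝ)) - (c + j * (1 / n : ℝ)) = (i - j) * (1 / n : ℝ) := by ring
      rw [this, abs_mul, abs_of_pos (a := (1 / n : ℝ)) (by positivity)]
      gcongr
      exact_mod_cast hij
    have hb := bil hs hBH hρ hσ (by positivity) (by positivity) (sep a _ _ hx'.1) (sep b _ _ hx'.2)
      (mC _ _) (mC _ _) (subC _ _) (subC _ _)
    have v1 : ∀ i j, volume (S ∩ φ ⁻¹' {i} ∩ ψ ⁻¹' {j}) ^ (1 / ρ) ≤ 1 := by
      intro i j
      have : volume (S ∩ φ ⁻¹' {i} ∩ ψ ⁻¹' {j}) ≤ 1 := by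
        refine (measure_mono (inter_subset_left.trans (inter_subset_left.trans hS))).trans ?_
        rw [unitSq, vol_rect _ _ _ _ (by norm_num)]; simp
      exact ENNReal.rpow_le_one this (by positivity)
    have hb2 : eLpNorm (fun p => e p x.1.1 x.1.2 * e p x.2.1 x.2.2) (ENNReal.ofReal s) volume ≤ B := by
      refine hb.trans ?_
      calc _ ≤ B * 1 * 1 := by gcongr <;> apply v1
        _ = B := by simp
    refine (setLIntegral_le_lintegral _ _).trans ?_
    have := ENNReal.rpow_le_rpow hb2 hs.le
    rw [eLpNorm_eq_lintegral_rpow_enorm_toReal (by simpa using hs) (by simp), ENNReal.toReal_ofReal hs.le, root_pow hs] at this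
    exact this
  have mV' : ∀ i, Measurable fun p => ‖extOp (chi (S ∩ φ ⁻¹' {i})) p‖ₑ ^ (2 * s) :=
    fun i => (sm_extOp (mV i)).enorm.pow_const _
  have mH' : ∀ i, Measurable fun p => ‖extOp (chi (S ∩ ψ ⁻¹' {i})) p‖ₑ ^ (2 * s) :=
    fun i => (sm_extOp (mH i)).enorm.pow_const _
  have mC' : ∀ i j, Measurable fun p => ‖e p i j‖ₑ ^ (2 * s) :=
    fun i j => (sm_extOp (mC i j)).enorm.pow_const _
  have mB' : ∀ x : (ℤ × ℤ) × (ℤ × ℤ), Measurable fun p => ‖e p x.1.1 x.1.2 * e p x.2.1 x.2.2‖ₑ ^ s :=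
    fun x => ((sm_extOp (mC _ _)).mul (sm_extOp (mC _ _))).enorm.pow_const _
  have pt : ∀ p, ‖extOp (chi S) p‖ₑ ^ (2 * s) ≤
      36 ^ (2 * s) * ((∑ i ∈ T, ‖extOp (chi (S ∩ φ ⁻¹' {i})) p‖ₑ ^ (2 * s)) +
        (∑ j ∈ T, ‖extOp (chi (S ∩ ψ ⁻¹' {j})) p‖ₑ ^ (2 * s)) +
        (∑ x ∈ T ×ˢ T, ‖e p x.1 x.2‖ₑ ^ (2 * s))) +
      4 ^ (2 * s) * (((n + 1) * (n + 1) : ℕ) : ℝ≥0∞) ^ (2 * s) *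
        ∑ x ∈ farPairs T, ‖e p x.1.1 x.1.2 * e p x.2.1 x.2.2‖ₑ ^ s := by
    intro p
    have := broad_narrow q0 T (e p)
    rw [eS p, cT] at this
    simp only [eV, eH] at this
    rwa [mul_div_cancel_left₀ s (by norm_num : (2 : ℝ) ≠ 0)] at this
  have m1 : Measurable fun p => (∑ i ∈ T, ‖extOp (chi (S ∩ φ ⁻¹' {i})) p‖ₑ ^ (2 * s)) :=
    Finset.measurable_fun_sum _ fun i _ => mV' i
  have m2 : Measurable fun p => (∑ j ∈ T, ‖extOp (chi (S ∩ ψ ⁻¹' {j})) p‖ₑ ^ (2 * s)) :=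
    Finset.measurable_fun_sum _ fun i _ => mH' i
  have m3 : Measurable fun p => (∑ x ∈ T ×ˢ T, ‖e p x.1 x.2‖ₑ ^ (2 * s)) :=
    Finset.measurable_fun_sum _ fun x _ => mC' x.1 x.2
  have m4 : Measurable fun p => ∑ x ∈ farPairs T, ‖e p x.1.1 x.1.2 * e p x.2.1 x.2.2‖ₑ ^ s :=
    Finset.measurable_fun_sum _ fun x _ => mB' x
  refine (lintegral_mono pt).trans ?_
  rw [lint4 _ _ m1 m2 m3 m4,
    lintegral_finsetSum _ (fun i _ => mV' i), lintegral_finsetSum _ (fun i _ => mH' i),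
    lintegral_finsetSum _ (fun x _ => mC' x.1 x.2), lintegral_finsetSum _ (fun x _ => mB' x)]
  have t1 := Finset.sum_le_card_nsmul T _ _ (fun i _ => iV i)
  have t2 := Finset.sum_le_card_nsmul T _ _ (fun i _ => iH i)
  have t3 := Finset.sum_le_card_nsmul (T ×ˢ T) _ _ (fun x _ => iC x.1 x.2)
  have t4 := Finset.sum_le_card_nsmul (farPairs T) _ _ iB
  rw [Finset.card_product] at t3
  rw [cT, nsmul_eq_mul] at t1 t2 t3
  rw [nsmul_eq_mul] at t4
  refine (add_le_add (mul_le_mul_right (add_le_add (add_le_add t1 t2) t3) _) (mul_le_mul_right t4 _)).trans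
    (le_of_eq ?_)
  have c1 : ENNReal.ofReal ((n + 1) * (1 / n : ℝ) ^ (2 * s - 2)) = ((n + 1 : ℕ) : ℝ≥0∞) * ENNReal.ofReal ((1 / n : ℝ) ^ (2 * s - 2)) := by
    rw [ENNReal.ofReal_mul (by positivity)]
    congr 1
    rw [← ENNReal.ofReal_natCast]; push_cast; rfl
  have c2 : ENNReal.ofReal (((n + 1) * (1 / n : ℝ) ^ (2 * s - 2)) ^ 2) = (((n + 1) * (n + 1) : ℕ) : ℝ≥0∞) * ENNReal.ofReal (((1 / n : ℝ) ^ (2 * s - 2)) ^ 2) := by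
    rw [mul_pow, ENNReal.ofReal_mul (by positivity)]
    congr 1
    rw [← ENNReal.ofReal_natCast]; push_cast; rw [pow_two]
  rw [c1, c2]
  ring

theorem exists_n {q η : ℝ} (hq : 3 < q) (hη : 0 < η) :
    ∃ n : ℕ, 0 < n ∧ (n + 1) * (1 / n : ℝ) ^ (q - 2) ≤ η := by
  have h1 := (tendsto_rpow_neg_atTop (y := q - 3) (by linarith)).comp tendsto_natCast_atTop_atTop
  have h2 := h1.eventually (gt_mem_nhds (show (0 : ℝ) < η / 2 by positivity))
  obtain ⟨n, hn, h3⟩ := (h2.and (Filter.eventually_gt_atTop 0)).exists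
  refine ⟨n, h3, ?_⟩
  have n0 : (0 : ℝ) < n := by exact_mod_cast h3
  have n1 : (1 : ℝ) ≤ n := by exact_mod_cast h3
  simp only [Function.comp] at hn
  have e : (n : ℝ) ^ (-(q - 3)) = n * (1 / n : ℝ) ^ (q - 2) := by
    rw [one_div, Real.inv_rpow n0.le, ← Real.rpow_neg n0.le]
    nth_rewrite 2 [← Real.rpow_one (n : ℝ)]
    rw [← Real.rpow_add n0]
    congr 1; ring
  have p : 0 < (1 / n : ℝ) ^ (q - 2) := by positivity
  nlinarith

theorem lin_unit {s r A ρ : ℝ} (hs : 3 / 2 < s) (hBH : BH s r A) (hρ : ρ = max r 1)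
    (hσ : 0 < 2 / ρ - 2 * (1 - 1 / s)) :
    ∃ D : ℝ≥0∞, D ≠ ∞ ∧ ∀ (a b : ℝ) (S : Set (ℝ × ℝ)), MeasurableSet S → S ⊆ unitSq a b →
      eLpNorm (extOp (chi S)) (ENNReal.ofReal (2 * s)) volume ≤ D := by
  have s0 : 0 < s := by linarith
  have q0 : 0 < 2 * s := by positivity
  obtain ⟨n, hn, hκ⟩ := exists_n (q := 2 * s) (η := 1 / (6 * 36 ^ (2 * s))) (by linarith) (by positivity)
  have step := fun M => lin_step (M := M) s0 hBH hρ hσ hn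
  set κ := (n + 1) * (1 / n : ℝ) ^ (2 * s - 2) with hκdef
  set D := 4 ^ (2 * s) * (((n + 1) * (n + 1) : ℕ) : ℝ≥0∞) ^ (2 * s) *
        ((farPairs (Finset.Icc 0 (n : ℤ))).card *
        (ENNReal.ofReal A * ENNReal.ofReal ((1 / n * (1 / n) : ℝ) ^ (-(2 / ρ - 2 * (1 - 1 / s))))) ^ s) with hD
  have Dfin : D ≠ ∞ := by
    rw [hD]
    refine ENNReal.mul_ne_top (ENNReal.mul_ne_top ?_ ?_) (ENNReal.mul_ne_top (by simp) ?_)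
    · exact ENNReal.rpow_ne_top_of_nonneg q0.le (by simp)
    · exact ENNReal.rpow_ne_top_of_nonneg q0.le (ENNReal.natCast_ne_top _)
    · exact ENNReal.rpow_ne_top_of_nonneg s0.le (ENNReal.mul_ne_top (by simp) (by simp))
  have κ0 : 0 ≤ κ := by positivity
  have h36 : (1 : ℝ) ≤ 36 ^ (2 * s) := Real.one_le_rpow (by norm_num) q0.le
  have small : (36 : ℝ≥0∞) ^ (2 * s) * (2 * ENNReal.ofReal κ + ENNReal.ofReal (κ ^ 2)) ≤ ENNReal.ofReal (1 / 2) := by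
    have e1 : (36 : ℝ≥0∞) ^ (2 * s) = ENNReal.ofReal (36 ^ (2 * s)) := by
      rw [← ENNReal.ofReal_rpow_of_pos (by norm_num)]; norm_num
    have e2 : (2 : ℝ≥0∞) = ENNReal.ofReal 2 := by norm_num
    rw [e1, e2, ← ENNReal.ofReal_mul (by norm_num), ← ENNReal.ofReal_add (by positivity) (by positivity),
      ← ENNReal.ofReal_mul (by positivity)]
    apply ENNReal.ofReal_le_ofReal
    rw [le_div_iff₀ (by positivity)] at hκ
    have : κ ≤ 1 := by nlinarith
    have : κ ^ 2 ≤ κ := by nlinarith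
    nlinarith
  have bound : ∀ M : ℝ≥0∞, M ≠ ∞ → sSup (linSet (2 * s) M) ≤ 2 * D := by
    intro M hM
    have fin : sSup (linSet (2 * s) M) ≠ ∞ := ne_top_of_le_ne_top hM (linSet_le q0.le M)
    have h1 := (step M).trans (add_le_add_left (mul_le_mul_left small _) _)
    set Q := sSup (linSet (2 * s) M)
    lift Q to NNReal using fin with Q'
    lift D to NNReal using Dfin with D'
    have h2 : (Q' : ℝ≥0∞) = ENNReal.ofReal (Q' : ℝ) := by simp
    have h3 : (D' : ℝ≥0∞) = ENNReal.ofReal (D' : ℝ) := by simp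
    have e2 : (2 : ℝ≥0∞) = ENNReal.ofReal 2 := by norm_num
    rw [h2, h3, ← ENNReal.ofReal_mul (by norm_num), ← ENNReal.ofReal_add (by positivity) (by positivity),
      ENNReal.ofReal_le_ofReal_iff (by positivity)] at h1
    rw [h2, h3, e2, ← ENNReal.ofReal_mul (by norm_num)]
    apply ENNReal.ofReal_le_ofReal
    linarith
  refine ⟨(2 * D) ^ (1 / (2 * s)), ENNReal.rpow_ne_top_of_nonneg (by positivity) (ENNReal.mul_ne_top (by simp) Dfin), ?_⟩
  intro a b S mS hS
  rw [eLpNorm_eq_lintegral_rpow_enorm_toReal (by simpa using s0) ENNReal.ofReal_ne_top, ENNReal.toReal_ofReal q0.le]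
  apply ENNReal.rpow_le_rpow _ (by positivity)
  apply lintegral_le_of_forall_fin_meas_le (μ := volume) (2 * D)
  intro X mX hX
  have mem : (∫⁻ p in X, ‖extOp (chi S) p‖ₑ ^ (2 * s)) ∈ linSet (2 * s) (volume X) :=
    ⟨a, b, S, X, mS, hS, mX, le_rfl, rfl⟩
  exact le_trans (le_sSup mem) (bound (volume X) hX)

theorem lin {s r A ρ : ℝ} (hs : 3 / 2 < s) (hBH : BH s r A) (hρ : ρ = max r 1)
    (hσ : 0 < 2 / ρ - 2 * (1 - 1 / s)) :
    ∃ Q : ℝ, 0 < Q ∧ ∀ (u v w h : ℝ) (S : Set (ℝ × ℝ)), 0 < w → 0 < h → MeasurableSet S →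
      S ⊆ Icc u (u + w) ×ˢ Icc v (v + h) →
      eLpNorm (extOp (chi S)) (ENNReal.ofReal (2 * s)) volume ≤
        ENNReal.ofReal (Q * (w * h) ^ (1 - 1 / s)) := by
  obtain ⟨D, hD, H⟩ := lin_unit hs hBH hρ hσ
  have s0 : 0 < s := by linarith
  refine ⟨D.toReal + 1, by positivity, ?_⟩
  intro u v w h S hw hh mS hS
  have m0 : 0 < w * h := by positivity
  have mT : MeasurableSet (dil w h ⁻¹' S) := meas_dil _ _ mS
  have e : extOp (chi S) = (((w * h) : ℝ) : ℂ) • (fun p => extOp (chi (dil w h ⁻¹' S)) (dil3 w h p)) := by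
    ext p
    simp only [Pi.smul_apply, smul_eq_mul]
    rw [extOp_scale hw hh mS]
  have n1 : ‖((w * h : ℝ) : ℂ)‖ₑ = ENNReal.ofReal (w * h) := by
    rw [← ofReal_norm, Complex.norm_real, Real.norm_of_nonneg (by positivity)]
  rw [e, eLpNorm_const_smul, eLpNorm_dil3 hw hh (by positivity) (sm_extOp mT), n1, ← mul_assoc,
    ← ENNReal.ofReal_mul (by positivity)]
  have c : (w * h) * ((w * h) ^ 2)⁻¹ ^ (1 / (2 * s)) = (w * h) ^ (1 - 1 / s) := by
    rw [← Real.rpow_natCast (w * h) 2, ← Real.rpow_neg m0.le, ← Real.rpow_mul m0.le]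
    nth_rewrite 1 [← Real.rpow_one (w * h)]
    rw [← Real.rpow_add m0]
    congr 1
    push_cast
    field_simp
    ring
  rw [c, mul_comm (D.toReal + 1), ENNReal.ofReal_mul (p := (w * h) ^ (1 - 1 / s)) (by positivity)]
  gcongr
  refine (H _ _ _ mT (dil_preimage_rect hw hh hS)).trans ?_
  rw [← ENNReal.ofReal_toReal hD]
  apply ENNReal.ofReal_le_ofReal
  rw [ENNReal.toReal_ofReal (by positivity)]
  linarith

theorem cover_bound {ι : Type*} (T : Finset ι) (R : ι → Set (ℝ × ℝ)) (mR : ∀ i, MeasurableSet (R i))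
    {G : ℝ × ℝ × ℝ → ℂ} (mG : StronglyMeasurable G) {p : ℝ≥0∞} (hp : 1 ≤ p) (B : ℝ≥0∞) :
    ∀ S : Set (ℝ × ℝ), MeasurableSet S → volume S ≠ ∞ → (S ⊆ ⋃ i ∈ T, R i) →
    (∀ S', MeasurableSet S' → ∀ i ∈ T, S' ⊆ S → S' ⊆ R i →
      eLpNorm (fun x => extOp (chi S') x * G x) p volume ≤ B) →
    eLpNorm (fun x => extOp (chi S) x * G x) p volume ≤ T.card * B := by
  classical
  induction T using Finset.induction_on with
  | empty =>
    intro S mS _ hS _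
    have : S = ∅ := by
      apply subset_empty_iff.1
      simpa using hS
    subst this
    simp [extOp_empty]
  | insert i T hi ih =>
    intro S mS fS hS H
    have e : (fun x => extOp (chi S) x * G x) = (fun x => extOp (chi (S ∩ R i)) x * G x) +
        (fun x => extOp (chi (S \ R i)) x * G x) := by
      ext x
      simp only [Pi.add_apply]
      rw [split_extOp mS fS (mR i), add_mul]
    have m1 := mS.inter (mR i)
    have m2 := mS.diff (mR i)
    rw [e, Finset.card_insert_of_notMem hi]
    refine (eLpNorm_add_le ((sm_extOp m1).mul mG).aestronglyMeasurable
      ((sm_extOp m2).mul mG).aestronglyMeasurable hp).trans ?_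
    push_cast
    rw [add_comm, add_mul, one_mul]
    apply add_le_add
    · apply ih _ m2 (measure_ne_top_of_subset sdiff_subset fS)
      · intro ξ hξ
        have := hS hξ.1
        simp only [Finset.mem_insert, mem_iUnion] at this ⊢
        obtain ⟨j, hj | hj, h⟩ := this
        · subst hj; exact absurd h hξ.2
        · exact ⟨j, hj, h⟩
      · intro S' mS' j hj h1 h2
        exact H S' mS' j (Finset.mem_insert_of_mem hj) (h1.trans sdiff_subset) h2
    · exact H _ m1 i (Finset.mem_insert_self _ _) inter_subset_left inter_subset_right

theorem holder2 {s : ℝ} (hs : 0 < s) {f g : ℝ × ℝ × ℝ → ℂ} (mf : StronglyMeasurable f)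
    (mg : StronglyMeasurable g) :
    eLpNorm (fun x => f x * g x) (ENNReal.ofReal s) volume ≤
      eLpNorm f (ENNReal.ofReal (2 * s)) volume * eLpNorm g (ENNReal.ofReal (2 * s)) volume := by
  have : ENNReal.HolderTriple (ENNReal.ofReal (2 * s)) (ENNReal.ofReal (2 * s)) (ENNReal.ofReal s) := by
    constructor
    rw [← ENNReal.ofReal_inv_of_pos (by positivity), ← ENNReal.ofReal_inv_of_pos hs,
      ← ENNReal.ofReal_add (by positivity) (by positivity)]
    congr 1
    field_simp
    norm_num
  have key := eLpNorm_le_eLpNorm_mul_eLpNorm_of_nnnorm (μ := (volume : Measure (ℝ × ℝ × ℝ)))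
    (p := ENNReal.ofReal (2 * s)) (q := ENNReal.ofReal (2 * s))
    (r := ENNReal.ofReal s) mf.aestronglyMeasurable mg.aestronglyMeasurable (fun a b : ℂ => a * b) 1
    (Filter.Eventually.of_forall fun x => by rw [one_mul, nnnorm_mul])
  rw [ENNReal.coe_one, one_mul] at key
  exact key

theorem cover_interval {x w : ℝ} {n : ℕ} (hn : 0 < n) (hw : 0 < w) {t : ℝ} (ht : t ∈ Icc x (x + w)) :
    ∃ i ∈ Finset.range n, t ∈ Icc (x + i * (w / n)) (x + i * (w / n) + w / n) := by
  have hn' : (0 : ℝ) < n := by exact_mod_cast hn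
  have h0 : 0 < w / n := by positivity
  have e : w / n * n = w := by field_simp
  by_cases hlast : t = x + w
  · refine ⟨n - 1, Finset.mem_range.2 (by omega), ?_⟩
    rw [Nat.cast_sub (by omega), hlast]
    push_cast
    constructor <;> nlinarith
  · have hlt : t < x + w := lt_of_le_of_ne ht.2 hlast
    have p0 : 0 ≤ (t - x) / (w / n) := div_nonneg (by linarith [ht.1]) h0.le
    refine ⟨⌊(t - x) / (w / n)⌋₊, Finset.mem_range.2 ?_, ?_⟩
    · rw [Nat.floor_lt p0, div_lt_iff₀ h0]
      nlinarith
    · have h1 := Nat.floor_le p0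
      have h2 := Nat.lt_floor_add_one ((t - x) / (w / n))
      rw [le_div_iff₀ h0] at h1
      rw [div_lt_iff₀ h0] at h2
      constructor <;> nlinarith

theorem rect_fin {u v w h : ℝ} (hw : 0 < w) {S : Set (ℝ × ℝ)}
    (hS : S ⊆ Icc u (u + w) ×ˢ Icc v (v + h)) : volume S ≤ ENNReal.ofReal (w * h) := by
  refine (measure_mono hS).trans ?_
  rw [vol_rect _ _ _ _ hw.le]

theorem pair {s r A ρ Q : ℝ} (hs : 3 / 2 < s) (hBH : BH s r A) (hρ : ρ = max r 1)
    (hσ : 0 < 2 / ρ - 2 * (1 - 1 / s)) (hQ0 : 0 < Q)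
    (hQ : ∀ (u v w h : ℝ) (S : Set (ℝ × ℝ)), 0 < w → 0 < h → MeasurableSet S →
      S ⊆ Icc u (u + w) ×ˢ Icc v (v + h) →
      eLpNorm (extOp (chi S)) (ENNReal.ofReal (2 * s)) volume ≤
        ENNReal.ofReal (Q * (w * h) ^ (1 - 1 / s)))
    {u u' wP hP x y wW hW a : ℝ} {n : ℕ} (hn : 0 < n) (wP0 : 0 < wP) (hP0 : 0 < hP) (wW0 : 0 < wW)
    (hW0 : 0 < hW) (c1 : n * wP ≤ wW) (c2 : n * hW ≤ hP) (a1 : wP * hP ≤ a) (a2 : wW * hW ≤ a)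
    {P W : Set (ℝ × ℝ)} (mP : MeasurableSet P) (mW : MeasurableSet W)
    (sP : P ⊆ Icc u (u + wP) ×ˢ Icc u' (u' + hP)) (sW : W ⊆ Icc x (x + wW) ×ˢ Icc y (y + hW)) :
    eLpNorm (fun p => extOp (chi P) p * extOp (chi W) p) (ENNReal.ofReal s) volume ≤
      ENNReal.ofReal (2 * Q ^ 2 * (5 * a / n) ^ (1 - 1 / s) * a ^ (1 - 1 / s) +
        n ^ 2 * |A| * (wW * hP / n ^ 2) ^ (-(2 / ρ - 2 * (1 - 1 / s))) * a ^ (2 / ρ)) := by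
  have hn' : (0 : ℝ) < n := by exact_mod_cast hn
  have hρ0 : 0 < ρ := by rw [hρ]; exact lt_of_lt_of_le one_pos (le_max_right _ _)
  have s0 : 0 < s := by linarith
  have hp1 : 1 ≤ ENNReal.ofReal s := by
    rw [← ENNReal.ofReal_one]; exact ENNReal.ofReal_le_ofReal (by linarith)
  have τ0 : 0 < 1 - 1 / s := by
    rw [sub_pos, div_lt_one s0]; linarith
  have a0 : 0 < a := lt_of_lt_of_le (by positivity) a1
  set τ := 1 - 1 / s with hτ
  set σ := 2 / ρ - 2 * τ with hσdef
  set h := wW / n with hh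
  set k := hP / n with hk
  have h0 : 0 < h := by positivity
  have k0 : 0 < k := by positivity
  have wPh : wP ≤ h := by rw [hh, le_div_iff₀ hn']; linarith
  have hWk : hW ≤ k := by rw [hk, le_div_iff₀ hn']; linarith
  have fP : volume P ≠ ∞ := ne_top_of_le_ne_top ENNReal.ofReal_ne_top (rect_fin wP0 sP)
  have fW : volume W ≠ ∞ := ne_top_of_le_ne_top ENNReal.ofReal_ne_top (rect_fin wW0 sW)
  -- near sets
  set NW : Set (ℝ × ℝ) := Icc (u - 2 * h) (u - 2 * h + 5 * h) ×ˢ univ with hNW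
  set NP : Set (ℝ × ℝ) := univ ×ˢ Icc (y - 2 * k) (y - 2 * k + 5 * k) with hNP
  have mNW : MeasurableSet NW := measurableSet_Icc.prod MeasurableSet.univ
  have mNP : MeasurableSet NP := MeasurableSet.univ.prod measurableSet_Icc
  have linP : eLpNorm (extOp (chi P)) (ENNReal.ofReal (2 * s)) volume ≤ ENNReal.ofReal (Q * a ^ τ) := by
    refine (hQ _ _ _ _ _ wP0 hP0 mP sP).trans ?_
    gcongr
  have linWf : eLpNorm (extOp (chi (W \ NW))) (ENNReal.ofReal (2 * s)) volume ≤ ENNReal.ofReal (Q * a ^ τ) := by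
    refine (hQ _ _ _ _ _ wW0 hW0 (mW.diff mNW) (sdiff_subset.trans sW)).trans ?_
    gcongr
  have linWn : eLpNorm (extOp (chi (W ∩ NW))) (ENNReal.ofReal (2 * s)) volume ≤
      ENNReal.ofReal (Q * (5 * a / n) ^ τ) := by
    refine (hQ (u - 2 * h) y (5 * h) hW _ (by positivity) hW0 (mW.inter mNW) ?_).trans ?_
    · intro ξ hξ; exact ⟨hξ.2.1, (sW hξ.1).2⟩
    · have : 5 * h * hW ≤ 5 * a / n := by
        rw [hh, le_div_iff₀ hn']
        calc 5 * (wW / n) * hW * n = 5 * (wW * hW) := by field_simp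
          _ ≤ 5 * a := by linarith
      gcongr
  have linPn : eLpNorm (extOp (chi (P ∩ NP))) (ENNReal.ofReal (2 * s)) volume ≤
      ENNReal.ofReal (Q * (5 * a / n) ^ τ) := by
    refine (hQ u (y - 2 * k) wP (5 * k) _ wP0 (by positivity) (mP.inter mNP) ?_).trans ?_
    · intro ξ hξ; exact ⟨(sP hξ.1).1, hξ.2.2⟩
    · have : wP * (5 * k) ≤ 5 * a / n := by
        rw [hk, le_div_iff₀ hn']
        calc wP * (5 * (hP / n)) * n = 5 * (wP * hP) := by field_simp
          _ ≤ 5 * a := by linarith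
      gcongr
  -- far-far part
  set B := ENNReal.ofReal (|A| * (wW * hP / n ^ 2) ^ (-σ) * a ^ (2 / ρ)) with hB
  have far : eLpNorm (fun p => extOp (chi (P \ NP)) p * extOp (chi (W \ NW)) p) (ENNReal.ofReal s) volume ≤
      n * (n * B) := by
    have mPf := mP.diff mNP
    have mWf := mW.diff mNW
    have := cover_bound (Finset.range n) (fun j : ℕ => (univ : Set ℝ) ×ˢ Icc (u' + j * k) (u' + j * k + k))
      (fun j => MeasurableSet.univ.prod measurableSet_Icc) (sm_extOp mWf) hp1 (n * B) (P \ NP) mPf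
      (measure_ne_top_of_subset sdiff_subset fP) ?_ ?_
    · simpa using this
    · intro ξ hξ
      obtain ⟨j, hj, h⟩ := cover_interval hn hP0 (sP hξ.1).2
      simp only [mem_iUnion]
      exact ⟨j, hj, ⟨trivial, h⟩⟩
    intro P' mP' j hj P'1 P'2
    have sw : (fun p => extOp (chi P') p * extOp (chi (W \ NW)) p) =
      fun p => extOp (chi (W \ NW)) p * extOp (chi P') p := by ext p; ring
    rw [sw]
    have := cover_bound (Finset.range n) (fun i : ℕ => Icc (x + i * h) (x + i * h + h) ×ˢ (univ : Set ℝ))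
      (fun j => measurableSet_Icc.prod MeasurableSet.univ) (sm_extOp mP') hp1 B (W \ NW) mWf
      (measure_ne_top_of_subset sdiff_subset fW) ?_ ?_
    · simpa using this
    · intro ξ hξ
      obtain ⟨j, hj, h⟩ := cover_interval hn wW0 (sW hξ.1).1
      simp only [mem_iUnion]
      exact ⟨j, hj, ⟨h, trivial⟩⟩
    intro W' mW' i hi W'1 W'2
    by_cases d1 : |x + i * h - u| < 2 * h
    · have : W' = ∅ := by
        rw [eq_empty_iff_forall_notMem]
        intro ξ hξ
        refine (W'1 hξ).2 ⟨?_, trivial⟩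
        have hx := (W'2 hξ).1
        rw [abs_lt] at d1
        constructor
        · linarith [hx.1]
        · linarith [hx.2]
      subst this
      simp [extOp_empty]
    by_cases d2 : |y - (u' + j * k)| < 2 * k
    · have : P' = ∅ := by
        rw [eq_empty_iff_forall_notMem]
        intro ξ hξ
        refine (P'1 hξ).2 ⟨trivial, ?_⟩
        have hx := (P'2 hξ).2
        rw [abs_lt] at d2
        constructor
        · linarith [hx.1]
        · linarith [hx.2]
      subst this
      simp [extOp_empty]
    have b := bil s0 hBH hρ hσ h0 k0 (not_lt.1 d1) (not_lt.1 d2) mW' mP'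
      (fun ξ hξ => ⟨(W'2 hξ).1, Icc_subset_Icc le_rfl (by linarith) (sW (W'1 hξ).1).2⟩)
      (fun ξ hξ => ⟨Icc_subset_Icc le_rfl (by linarith) (sP (P'1 hξ).1).1, (P'2 hξ).2⟩)
    refine b.trans ?_
    have vP : volume P' ^ (1 / ρ) ≤ ENNReal.ofReal (a ^ (1 / ρ)) := by
      rw [← ENNReal.ofReal_rpow_of_pos a0]
      apply ENNReal.rpow_le_rpow _ (by positivity)
      exact (rect_fin wP0 ((P'1.trans sdiff_subset).trans sP)).trans (ENNReal.ofReal_le_ofReal a1)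
    have vW : volume W' ^ (1 / ρ) ≤ ENNReal.ofReal (a ^ (1 / ρ)) := by
      rw [← ENNReal.ofReal_rpow_of_pos a0]
      apply ENNReal.rpow_le_rpow _ (by positivity)
      exact (rect_fin wW0 ((W'1.trans sdiff_subset).trans sW)).trans (ENNReal.ofReal_le_ofReal a2)
    have ehk : h * k = wW * hP / n ^ 2 := by rw [hh, hk]; field_simp
    have ea : a ^ (2 / ρ) = a ^ (1 / ρ) * a ^ (1 / ρ) := by
      rw [← Real.rpow_add a0]; congr 1; ring
    rw [hB, ea, ← mul_assoc, ENNReal.ofReal_mul (by positivity), ENNReal.ofReal_mul (by positivity),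
      ENNReal.ofReal_mul (by positivity), ehk]
    gcongr
    exact le_abs_self A
  have e : (fun p => extOp (chi P) p * extOp (chi W) p) =
      (fun p => extOp (chi P) p * extOp (chi (W ∩ NW)) p) +
      ((fun p => extOp (chi (P ∩ NP)) p * extOp (chi (W \ NW)) p) +
       (fun p => extOp (chi (P \ NP)) p * extOp (chi (W \ NW)) p)) := by
    ext p
    simp only [Pi.add_apply]
    rw [split_extOp mW fW mNW p, ← add_mul, ← split_extOp mP fP mNP p]
    ring
  have sm1 := (sm_extOp mP).mul (sm_extOp (mW.inter mNW))
  have sm2 := (sm_extOp (mP.inter mNP)).mul (sm_extOp (mW.diff mNW))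
  have sm3 := (sm_extOp (mP.diff mNP)).mul (sm_extOp (mW.diff mNW))
  rw [e]
  refine (eLpNorm_add_le sm1.aestronglyMeasurable (sm2.add sm3).aestronglyMeasurable hp1).trans ?_
  refine (add_le_add_right (eLpNorm_add_le sm2.aestronglyMeasurable sm3.aestronglyMeasurable hp1) _).trans ?_
  have t1 := (holder2 s0 (sm_extOp mP) (sm_extOp (mW.inter mNW))).trans (mul_le_mul' linP linWn)
  have t2 := (holder2 s0 (sm_extOp (mP.inter mNP)) (sm_extOp (mW.diff mNW))).trans (mul_le_mul' linPn linWf)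
  refine (add_le_add t1 (add_le_add t2 far)).trans (le_of_eq ?_)
  rw [hB, ← ENNReal.ofReal_natCast, ← ENNReal.ofReal_mul (by positivity), ← ENNReal.ofReal_mul (by positivity),
    ← ENNReal.ofReal_mul (by positivity), ← ENNReal.ofReal_mul (by positivity),
    ← ENNReal.ofReal_add (by positivity) (by positivity), ← ENNReal.ofReal_add (by positivity) (by positivity)]
  congr 1
  ring

theorem pair_gain {s r A ρ : ℝ} (hs : 3 / 2 < s) (hBH : BH s r A) (hρ : ρ = max r 1)
    (hσ : 0 < 2 / ρ - 2 * (1 - 1 / s)) :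
    ∃ C c : ℝ, 0 < C ∧ 0 < c ∧ ∀ (N a u u' wP hP x y wW hW : ℝ) (P W : Set (ℝ × ℝ)),
      0 ≤ N → 0 < wP → 0 < hP → 0 < wW → 0 < hW →
      (2 : ℝ) ^ (N / 2) * wP ≤ wW → (2 : ℝ) ^ (N / 2) * hW ≤ hP → wP * hP ≤ a → wW * hW ≤ a →
      a * (2 : ℝ) ^ (N / 2) ≤ wW * hP →
      MeasurableSet P → MeasurableSet W →
      P ⊆ Icc u (u + wP) ×ˢ Icc u' (u' + hP) → W ⊆ Icc x (x + wW) ×ˢ Icc y (y + hW) →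
      eLpNorm (fun p => extOp (chi P) p * extOp (chi W) p) (ENNReal.ofReal s) volume ≤
        ENNReal.ofReal (C * (2 : ℝ) ^ (-(c * N)) * a ^ (2 * (1 - 1 / s))) := by
  obtain ⟨Q, hQ0, hQ⟩ := lin hs hBH hρ hσ
  have s0 : 0 < s := by linarith
  have τ0 : 0 < 1 - 1 / s := by
    rw [sub_pos, div_lt_one s0]; linarith
  have pair' := @pair s r A ρ Q hs hBH hρ hσ hQ0 hQ
  generalize hτ : 1 - 1 / s = τ at *
  generalize hσd : 2 / ρ - 2 * τ = σ at *
  have hρσ : 2 / ρ = 2 * τ + σ := by linarith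
  rw [hρσ] at pair'
  set θ := min (1 / 2) (σ / (8 * (1 + σ))) with hθ
  have θ0 : 0 < θ := lt_min (by norm_num) (by positivity)
  have θ1 : θ ≤ 1 / 2 := min_le_left _ _
  have θ2 : θ * (2 + 2 * σ) ≤ σ / 4 := by
    have : θ ≤ σ / (8 * (1 + σ)) := min_le_right _ _
    rw [le_div_iff₀ (by positivity)] at this
    linarith
  refine ⟨2 * Q ^ 2 * 10 ^ τ + |A|, min (θ * τ) (σ / 4), by positivity, lt_min (by positivity) (by positivity), ?_⟩
  intro N a u u' wP hP x y wW hW P W hN wP0 hP0 wW0 hW0 h1 h2 a1 a2 h3 mP mW sP sW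
  have a0 : 0 < a := lt_of_lt_of_le (by positivity) a1
  set c := min (θ * τ) (σ / 4) with hc
  set n := ⌊(2 : ℝ) ^ (θ * N)⌋₊ with hn
  have b1 : (1 : ℝ) ≤ (2 : ℝ) ^ (θ * N) := Real.one_le_rpow (by norm_num) (by positivity)
  have n1 : 1 ≤ n := Nat.le_floor (by exact_mod_cast b1)
  have n1' : (1 : ℝ) ≤ n := by exact_mod_cast n1
  have n0 : (0 : ℝ) < n := by linarith
  have nle : (n : ℝ) ≤ (2 : ℝ) ^ (θ * N) := Nat.floor_le (by positivity)
  have nge : (2 : ℝ) ^ (θ * N) / 2 ≤ n := by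
    have := Nat.lt_floor_add_one ((2 : ℝ) ^ (θ * N))
    rw [← hn] at this
    linarith
  have nle2 : (n : ℝ) ≤ (2 : ℝ) ^ (N / 2) := nle.trans
    (Real.rpow_le_rpow_of_exponent_le (by norm_num) (by nlinarith))
  have key := pair' (u := u) (u' := u') (x := x) (y := y) (a := a) (n := n) (by omega) wP0 hP0 wW0 hW0
    ((mul_le_mul_of_nonneg_right nle2 wP0.le).trans h1)
    ((mul_le_mul_of_nonneg_right nle2 hW0.le).trans h2) a1 a2 mP mW sP sW
  refine key.trans (ENNReal.ofReal_le_ofReal ?_)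
  have e0 : a ^ (2 * τ) = a ^ τ * a ^ τ := by rw [← Real.rpow_add a0]; ring_nf
  have g1 : (5 * a / n) ^ τ ≤ 10 ^ τ * a ^ τ * (2 : ℝ) ^ (-(c * N)) := by
    have : 5 * a / n ≤ 10 * a * (2 : ℝ) ^ (-(θ * N)) := by
      rw [div_le_iff₀ n0, Real.rpow_neg (by norm_num)]
      have hp : (0 : ℝ) < (2 : ℝ) ^ (θ * N) := by positivity
      have : 10 * a * ((2 : ℝ) ^ (θ * N))⁻¹ * ((2 : ℝ) ^ (θ * N) / 2) ≤ 10 * a * ((2 : ℝ) ^ (θ * N))⁻¹ * n :=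
        mul_le_mul_of_nonneg_left nge (by positivity)
      refine le_trans (le_of_eq ?_) this
      field_simp
      norm_num
    refine (Real.rpow_le_rpow (by positivity) this τ0.le).trans ?_
    rw [Real.mul_rpow (by positivity) (by positivity), Real.mul_rpow (by norm_num) a0.le,
      ← Real.rpow_mul (by norm_num)]
    refine mul_le_mul_of_nonneg_left (Real.rpow_le_rpow_of_exponent_le (by norm_num) ?_) (by positivity)
    have : c * N ≤ θ * τ * N := mul_le_mul_of_nonneg_right (min_le_left _ _) hN
    linarith
  have g2 : (n : ℝ) ^ 2 * (wW * hP / n ^ 2) ^ (-σ) ≤ a ^ (-σ) * (2 : ℝ) ^ (-(c * N)) := by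
    have q1 : (wW * hP / n ^ 2) ^ (-σ) ≤ (a * (2 : ℝ) ^ (N / 2) / n ^ 2) ^ (-σ) := by
      apply Real.rpow_le_rpow_of_nonpos (by positivity) _ (by linarith)
      gcongr
    have q2 : (n : ℝ) ^ 2 * (a * (2 : ℝ) ^ (N / 2) / n ^ 2) ^ (-σ) =
        a ^ (-σ) * (2 : ℝ) ^ (-(σ * N / 2)) * (n : ℝ) ^ (2 + 2 * σ) := by
      rw [Real.div_rpow (by positivity) (by positivity), Real.mul_rpow a0.le (by positivity),
        ← Real.rpow_mul (by norm_num), ← Real.rpow_natCast, ← Real.rpow_mul n0.le,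
        Real.rpow_add n0, div_eq_mul_inv, ← Real.rpow_neg n0.le]
      push_cast
      rw [show N / 2 * -σ = -(σ * N / 2) by ring, show -(2 * -σ) = 2 * σ by ring]
      ring
    have q3 : (n : ℝ) ^ (2 + 2 * σ) ≤ (2 : ℝ) ^ (σ * N / 4) := by
      refine (Real.rpow_le_rpow n0.le nle (by positivity)).trans ?_
      rw [← Real.rpow_mul (by norm_num)]
      refine Real.rpow_le_rpow_of_exponent_le (by norm_num) ?_
      nlinarith
    calc (n : ℝ) ^ 2 * (wW * hP / n ^ 2) ^ (-σ) ≤ (n : ℝ) ^ 2 * (a * (2 : ℝ) ^ (N / 2) / n ^ 2) ^ (-σ) := by gcongr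
      _ = _ := q2
      _ ≤ a ^ (-σ) * (2 : ℝ) ^ (-(σ * N / 2)) * (2 : ℝ) ^ (σ * N / 4) := by gcongr
      _ = a ^ (-σ) * (2 : ℝ) ^ (-(σ / 4 * N)) := by
        rw [mul_assoc, ← Real.rpow_add (by norm_num)]; ring_nf
      _ ≤ _ := by
        refine mul_le_mul_of_nonneg_left (Real.rpow_le_rpow_of_exponent_le (by norm_num) ?_) (by positivity)
        have : c * N ≤ σ / 4 * N := mul_le_mul_of_nonneg_right (min_le_right _ _) hN
        linarith
  have e2 : a ^ (-σ) * a ^ (2 * τ + σ) = a ^ (2 * τ) := by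
    rw [← Real.rpow_add a0]; ring_nf
  calc _ = 2 * Q ^ 2 * (5 * a / n) ^ τ * a ^ τ + |A| * ((n : ℝ) ^ 2 * (wW * hP / n ^ 2) ^ (-σ)) * a ^ (2 * τ + σ) := by ring
    _ ≤ 2 * Q ^ 2 * (10 ^ τ * a ^ τ * (2 : ℝ) ^ (-(c * N))) * a ^ τ +
        |A| * (a ^ (-σ) * (2 : ℝ) ^ (-(c * N))) * a ^ (2 * τ + σ) := by gcongr
    _ = 2 * Q ^ 2 * 10 ^ τ * (2 : ℝ) ^ (-(c * N)) * (a ^ τ * a ^ τ) +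
        |A| * (2 : ℝ) ^ (-(c * N)) * (a ^ (-σ) * a ^ (2 * τ + σ)) := by ring
    _ = _ := by rw [e2, ← e0]; ring

theorem meas_vf {Ω : Set (ℝ × ℝ)} (mΩ : MeasurableSet Ω) : Measurable fun x => volume (vFiber Ω x) :=
  measurable_measure_prodMk_left mΩ

theorem fiber_meas {Ω : Set (ℝ × ℝ)} (mΩ : MeasurableSet Ω) (K : ℕ) :
    MeasurableSet (fiberPiece Ω K) := by
  have h : Measurable fun ξ : ℝ × ℝ => volume (vFiber Ω ξ.1) := (meas_vf mΩ).comp measurable_fst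
  exact mΩ.inter ((measurableSet_le measurable_const h).inter (measurableSet_le h measurable_const))

theorem fiber_vol {Ω : Set (ℝ × ℝ)} (mΩ : MeasurableSet Ω) (K : ℕ) :
    (2 : ℝ≥0∞) ^ (-(K : ℤ) - 1) * volume (Prod.fst '' fiberPiece Ω K) ≤ volume (fiberPiece Ω K) ∧
    volume (fiberPiece Ω K) ≤ (2 : ℝ≥0∞) ^ (-(K : ℤ) + 1) * volume (Prod.fst '' fiberPiece Ω K) := by
  set I : Set ℝ := {x | (2 : ℝ≥0∞) ^ (-(K : ℤ) - 1) ≤ volume (vFiber Ω x) ∧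
    volume (vFiber Ω x) ≤ (2 : ℝ≥0∞) ^ (-(K : ℤ) + 1)} with hI
  have mI : MeasurableSet I :=
    (measurableSet_le measurable_const (meas_vf mΩ)).inter (measurableSet_le (meas_vf mΩ) measurable_const)
  have eI : Prod.fst '' fiberPiece Ω K = I := by
    ext x
    constructor
    · rintro ⟨ξ, hξ, rfl⟩
      exact hξ.2
    · intro hx
      have : volume (vFiber Ω x) ≠ 0 := by
        intro h0
        have := hx.1
        rw [h0, nonpos_iff_eq_zero] at this
        exact (ENNReal.zpow_pos (by norm_num) (by norm_num) _).ne' this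
      obtain ⟨y, hy⟩ := nonempty_of_measure_ne_zero this
      exact ⟨(x, y), ⟨hy, hx⟩, rfl⟩
  have ev : volume (fiberPiece Ω K) = ∫⁻ x in I, volume (vFiber Ω x) := by
    rw [Measure.volume_eq_prod, Measure.prod_apply (fiber_meas mΩ K), ← lintegral_indicator mI]
    congr 1
    ext x
    by_cases hx : x ∈ I
    · rw [indicator_of_mem hx]
      congr 1
      ext y
      exact ⟨fun h => h.1, fun h => ⟨h, hx⟩⟩
    · rw [indicator_of_notMem hx]
      convert measure_empty (μ := (volume : Measure ℝ))
      ext y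
      simp only [mem_preimage, mem_empty_iff_false, iff_false]
      exact fun h => hx h.2
  rw [eI, ev]
  constructor
  · rw [← setLIntegral_const]
    exact setLIntegral_mono (meas_vf mΩ) fun x hx => hx.1
  · rw [← setLIntegral_const]
    exact setLIntegral_mono measurable_const fun x hx => hx.2

/-- Real-number form of the size of a fiber piece. -/
theorem fiber_real {Ω : Set (ℝ × ℝ)} (mΩ : MeasurableSet Ω) (K J : ℕ)
    (h : (2 : ℝ≥0∞) ^ (-(J : ℤ) - 1) ≤ volume (Prod.fst '' fiberPiece Ω K) ∧
            volume (Prod.fst '' fiberPiece Ω K) ≤ (2 : ℝ≥0∞) ^ (-(J : ℤ) + 1)) :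
    ∃ V : ℝ, volume (fiberPiece Ω K) = ENNReal.ofReal V ∧ (2 : ℝ) ^ (-((J : ℝ) + K)) ≤ 4 * V ∧
      V ≤ 4 * (2 : ℝ) ^ (-((J : ℝ) + K)) := by
  have z : ∀ m : ℤ, (2 : ℝ≥0∞) ^ m = ENNReal.ofReal ((2 : ℝ) ^ (m : ℝ)) := by
    intro m
    rw [← ENNReal.rpow_intCast, ← ENNReal.ofReal_rpow_of_pos (by norm_num)]
    norm_num
  obtain ⟨h1, h2⟩ := fiber_vol mΩ K
  have l := (mul_le_mul_right h.1 ((2 : ℝ≥0∞) ^ (-(K : ℤ) - 1))).trans h1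
  have r := h2.trans (mul_le_mul_right h.2 ((2 : ℝ≥0∞) ^ (-(K : ℤ) + 1)))
  rw [z, z, ← ENNReal.ofReal_mul (by positivity), ← Real.rpow_add (by norm_num)] at l r
  push_cast at l r
  have ft : volume (fiberPiece Ω K) ≠ ∞ := ne_top_of_le_ne_top ENNReal.ofReal_ne_top r
  refine ⟨(volume (fiberPiece Ω K)).toReal, (ENNReal.ofReal_toReal ft).symm, ?_, ?_⟩
  · have := (ENNReal.ofReal_le_iff_le_toReal ft).1 l
    rw [show -(K : ℝ) - 1 + (-(J : ℝ) - 1) = -((J : ℝ) + K) - 2 by ring, Real.rpow_sub (by norm_num)] at this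
    norm_num at this
    rw [div_le_iff₀ (by norm_num)] at this
    have e : -((J : ℝ) + K) = -(K : ℝ) + -(J : ℝ) := by ring
    first | linarith | (rw [e]; linarith)
  · have := ENNReal.toReal_le_of_le_ofReal (by positivity) r
    rw [show -(K : ℝ) + 1 + (-(J : ℝ) + 1) = -((J : ℝ) + K) + 2 by ring, Real.rpow_add (by norm_num)] at this
    refine this.trans (le_of_eq ?_)
    norm_num
    ring

theorem tile_eq (j k : ℕ) (m m' : ℤ) : ∃ u v : ℝ, tile (j : ℤ) (k : ℤ) m m' =
    Icc u (u + (2 : ℝ) ^ (-(j : ℝ))) ×ˢ Icc v (v + (2 : ℝ) ^ (-(k : ℝ))) := by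
  have z : ∀ n : ℕ, (2 : ℝ) ^ (-(n : ℝ)) = (2 : ℝ) ^ (-(n : ℤ)) := by
    intro n
    rw [← Real.rpow_intCast]; push_cast; rfl
  refine ⟨m * 2 ^ (-(j : ℤ)), m' * 2 ^ (-(k : ℤ)), ?_⟩
  rw [tile, dyadicIcc, dyadicIcc, z, z, add_one_mul, add_one_mul]

theorem tile_meas (j k m m' : ℤ) : MeasurableSet (tile j k m m') :=
  measurableSet_Icc.prod measurableSet_Icc

theorem near_pair {s C c : ℝ} (hs : 3 / 2 < s)
    (H : ∀ (N a u u' wP hP x y wW hW : ℝ) (P W : Set (ℝ × ℝ)),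
      0 ≤ N → 0 < wP → 0 < hP → 0 < wW → 0 < hW →
      (2 : ℝ) ^ (N / 2) * wP ≤ wW → (2 : ℝ) ^ (N / 2) * hW ≤ hP → wP * hP ≤ a → wW * hW ≤ a →
      a * (2 : ℝ) ^ (N / 2) ≤ wW * hP →
      MeasurableSet P → MeasurableSet W →
      P ⊆ Icc u (u + wP) ×ˢ Icc u' (u' + hP) → W ⊆ Icc x (x + wW) ×ˢ Icc y (y + hW) →
      eLpNorm (fun p => extOp (chi P) p * extOp (chi W) p) (ENNReal.ofReal s) volume ≤
        ENNReal.ofReal (C * (2 : ℝ) ^ (-(c * N)) * a ^ (2 * (1 - 1 / s))))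
    {J₁ K₁ J₂ K₂ : ℕ} {N e : ℝ} (hN : 0 ≤ N) (n1 : N / 2 ≤ (J₁ : ℝ) - J₂) (n2 : N / 2 ≤ (K₂ : ℝ) - K₁)
    (n3 : e ≤ (J₁ : ℝ) + K₁) (n4 : e ≤ (J₂ : ℝ) + K₂) (n5 : (J₂ : ℝ) + K₁ ≤ e - N / 2)
    {S₁ S₂ : Set (ℝ × ℝ)} (m1 : MeasurableSet S₁) (m2 : MeasurableSet S₂) (f1 : volume S₁ ≠ ∞)
    (f2 : volume S₂ ≠ ∞) {T₁ T₂ : Finset (ℤ × ℤ)}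
    (t1 : S₁ ⊆ ⋃ p ∈ T₁, tile (J₁ : ℤ) (K₁ : ℤ) p.1 p.2)
    (t2 : S₂ ⊆ ⋃ p ∈ T₂, tile (J₂ : ℤ) (K₂ : ℤ) p.1 p.2) :
    eLpNorm (fun p => extOp (chi S₁) p * extOp (chi S₂) p) (ENNReal.ofReal s) volume ≤
      T₁.card * (T₂.card *
        ENNReal.ofReal (C * (2 : ℝ) ^ (-(c * N)) * ((2 : ℝ) ^ (-e)) ^ (2 * (1 - 1 / s)))) := by
  have hp1 : 1 ≤ ENNReal.ofReal s := by
    rw [← ENNReal.ofReal_one]; exact ENNReal.ofReal_le_ofReal (by linarith)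
  refine cover_bound T₁ (fun p => tile (J₁ : ℤ) (K₁ : ℤ) p.1 p.2) (fun _ => tile_meas _ _ _ _)
    (sm_extOp m2) hp1 _ S₁ m1 f1 t1 ?_
  intro P mP i _ _ sP
  have := cover_bound T₂ (fun p => tile (J₂ : ℤ) (K₂ : ℤ) p.1 p.2) (fun _ => tile_meas _ _ _ _)
    (sm_extOp mP) hp1 (ENNReal.ofReal (C * (2 : ℝ) ^ (-(c * N)) * ((2 : ℝ) ^ (-e)) ^ (2 * (1 - 1 / s))))
      S₂ m2 f2 t2 ?_
  · simpa only [mul_comm (extOp (chi P) _)] using this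
  intro W mW j _ _ sW
  obtain ⟨u, u', hu⟩ := tile_eq J₁ K₁ i.1 i.2
  obtain ⟨x, y, hx⟩ := tile_eq J₂ K₂ j.1 j.2
  rw [hu] at sP
  rw [hx] at sW
  have := H N ((2 : ℝ) ^ (-e)) u u' _ _ x y _ _ P W hN (by positivity) (by positivity) (by positivity)
    (by positivity) ?_ ?_ ?_ ?_ ?_ mP mW sP sW
  · simpa only [mul_comm (extOp (chi W) _)] using this
  all_goals
    rw [← Real.rpow_add (by norm_num)]
    try rw [← Real.rpow_add (by norm_num)]
    refine Real.rpow_le_rpow_of_exponent_le (by norm_num) ?_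
    linarith

theorem delta_small {C₁ C₂ δ : ℝ} (hC₁ : 0 < C₁) (hC₂ : 0 < C₂) (hδ : 0 < δ)
    (h : 1 ≤ C₁ * δ ^ (-C₂)) : δ ≤ C₁ ^ (1 / C₂) := by
  have h1 : δ ^ C₂ ≤ C₁ := by
    rw [Real.rpow_neg hδ.le, ← div_eq_mul_inv, le_div_iff₀ (by positivity)] at h
    linarith
  calc δ = (δ ^ C₂) ^ (1 / C₂) := by
        rw [← Real.rpow_mul hδ.le, mul_one_div_cancel hC₂.ne', Real.rpow_one]
    _ ≤ _ := Real.rpow_le_rpow (by positivity) h1 (by positivity)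

theorem delta_sep {C₂ c δ N : ℝ} (hC₂ : 0 < C₂) (hc : 0 < c) (hδ : 0 < δ)
    (h : 4 * C₂ / (c * Real.log 2) * Real.log δ⁻¹ ≤ N) :
    δ ^ (-C₂) * δ ^ (-C₂) ≤ (2 : ℝ) ^ (c / 2 * N) := by
  have l2 : 0 < Real.log 2 := Real.log_pos (by norm_num)
  rw [← Real.rpow_add hδ, Real.rpow_def_of_pos hδ, Real.rpow_def_of_pos (by norm_num)]
  apply Real.exp_le_exp.2
  rw [Real.log_inv, div_mul_eq_mul_div, div_le_iff₀ (by positivity)] at h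
  linarith

/-- off-diagonal fourfold product bound: under BH(s,r) with `3/2 < s < 2`,
`r < s'`, and given constants `C₁, C₂ > 0` quantifying the near-tile decomposition, there are
admissible constants `A₀` (the required separation constant), `c₀ > 0` and `C₃ > 0` such that
the following holds.  With `Ω, ε, δ, J, Ω_δ(K)` as in the decoupling setup and `𝓚 ⊆ 𝓚(ε)`
such that `𝓚` and `{J(K) : K ∈ 𝓚}` are `A₀ log δ⁻¹`-separated, if `K₁, K₂, K₃, K₄ ∈ 𝓚` are
not all equal, `K₁ + J(K₁)` is minimal among the `Kᵢ + J(Kᵢ)`, and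
`|K₁ - K₄| ≥ |Kᵢ - Kⱼ|/2` for all `i, j`, then
`∥∏_{i=1}^4 𝓔χ_{Ω_δ(Kᵢ)}∥_{L^{s/2}} ≤ C₃ 2^{-c₀|K₁-K₄|} |Ω(K₁)|^{4/s'}`. -/
theorem stmt14 (s r A C₁ C₂ : ℝ) (hs₁ : 3 / 2 < s) (hs₂ : s < 2) (hr : r < s / (s - 1))
    (hBH : BH s r A) (hC₁ : 0 < C₁) (hC₂ : 0 < C₂) :
    ∃ A₀ c₀ C₃ : ℝ, 0 < A₀ ∧ 0 < c₀ ∧ 0 < C₃ ∧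
      ∀ (Ω : Set (ℝ × ℝ)), MeasurableSet Ω → Ω ⊆ Icc 0 1 ×ˢ Icc 0 1 →
      ∀ (ε δ : ℝ), IsDyadic ε → IsDyadic δ → 0 < δ → δ ≤ ε →
      ∀ (J : ℕ → ℕ) (Ωδ : ℕ → Set (ℝ × ℝ)) (𝓚 : Set ℕ), 𝓚 ⊆ KsetOf s Ω ε →
        (∀ K ∈ KsetOf s Ω ε,
          (2 : ℝ≥0∞) ^ (-(J K : ℤ) - 1) ≤ volume (Prod.fst '' fiberPiece Ω K) ∧
            volume (Prod.fst '' fiberPiece Ω K) ≤ (2 : ℝ≥0∞) ^ (-(J K : ℤ) + 1)) →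
        (∀ K ∈ KsetOf s Ω ε, MeasurableSet (Ωδ K) ∧ Ωδ K ⊆ fiberPiece Ω K ∧
          (∃ T : Finset (ℤ × ℤ), (T.card : ℝ) ≤ C₁ * δ ^ (-C₂) ∧
            Ωδ K ⊆ ⋃ p ∈ T, tile (J K : ℤ) (K : ℤ) p.1 p.2) ∧
          ∀ Ω' ⊆ Ωδ K, MeasurableSet Ω' →
            eLpNorm (extOp (chi Ω')) (ENNReal.ofReal (2 * s)) volume ≤
              ENNReal.ofReal (C₁ * δ) * volume (fiberPiece Ω K) ^ (1 - 1 / s)) →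
        (∀ K ∈ 𝓚, ∀ K' ∈ 𝓚, K ≠ K' →
          A₀ * Real.log δ⁻¹ ≤ |(K : ℝ) - (K' : ℝ)| ∧
            A₀ * Real.log δ⁻¹ ≤ |(J K : ℝ) - (J K' : ℝ)|) →
        ∀ Ks : Fin 4 → ℕ, (∀ i, Ks i ∈ 𝓚) → (¬ ∀ i j, Ks i = Ks j) →
          (∀ i, Ks 0 + J (Ks 0) ≤ Ks i + J (Ks i)) →
          (∀ i j, |(Ks i : ℝ) - (Ks j : ℝ)| / 2 ≤ |(Ks 0 : ℝ) - (Ks 3 : ℝ)|) →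
          eLpNorm (fun p => ∏ i, extOp (chi (Ωδ (Ks i))) p)
              (ENNReal.ofReal (s / 2)) volume ≤
            ENNReal.ofReal (C₃ * 2 ^ (-(c₀ * |(Ks 0 : ℝ) - (Ks 3 : ℝ)|))) *
              volume (fiberPiece Ω (Ks 0)) ^ (4 * (1 - 1 / s)) := by
  have s0 : 0 < s := by linarith
  have τ0 : 0 < 1 - 1 / s := by
    rw [sub_pos, div_lt_one s0]; linarith
  have hσ : 0 < 2 / max r 1 - 2 * (1 - 1 / s) := by
    have h1 : max r 1 < s / (s - 1) := by
      apply max_lt hr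
      rw [lt_div_iff₀ (by linarith)]; linarith
    have h0 : 0 < max r 1 := lt_of_lt_of_le one_pos (le_max_right _ _)
    have h2 : max r 1 * (s - 1) < s := by rwa [lt_div_iff₀ (by linarith)] at h1
    have h3 : 1 - 1 / s = (s - 1) / s := by field_simp
    have h4 : (s - 1) / s < 1 / max r 1 := by
      rw [div_lt_div_iff₀ s0 h0]; linarith
    rw [h3, show 2 / max r 1 = 2 * (1 / max r 1) by ring]
    linarith
  obtain ⟨C, c, hC, hc, H⟩ := pair_gain hs₁ hBH rfl hσ
  have NP := @near_pair s C c hs₁ H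
  have l2 : 0 < Real.log 2 := Real.log_pos (by norm_num)
  clear H hσ
  generalize hτ : 1 - 1 / s = τ at *
  set M := C₁ * C₁ ^ (1 / C₂) * 16 ^ τ with hM
  have M0 : 0 < M := by positivity
  set B := M ^ 2 + C₁ ^ 2 * C * 4 ^ (2 * τ) with hB
  have B0 : 0 < B := by positivity
  refine ⟨4 * C₂ / (c * Real.log 2), min (c / 2) (τ / 2), B * M ^ 2, by positivity,
    lt_min (by positivity) (by positivity), by positivity, ?_⟩
  set c₀ := min (c / 2) (τ / 2) with hc₀
  intro Ω mΩ _ ε δ _ _ hδ _ J Ωδ 𝓚 h𝓚 hJ hΩδ hsep Ks hKs hne hmin hfar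
  have hK : ∀ i, Ks i ∈ KsetOf s Ω ε := fun i => h𝓚 (hKs i)
  set N := |(Ks 0 : ℝ) - (Ks 3 : ℝ)| with hN
  have N0 : 0 ≤ N := abs_nonneg _
  have K03 : Ks 0 ≠ Ks 3 := by
    intro h
    apply hne
    intro i j
    have h1 := hfar i j
    have h2 : N = 0 := by rw [hN, h]; simp
    rw [h2] at h1
    have h3 : |(Ks i : ℝ) - Ks j| = 0 := le_antisymm (by linarith) (abs_nonneg _)
    have h4 := abs_eq_zero.1 h3
    exact_mod_cast sub_eq_zero.1 h4
  have sep := delta_sep hC₂ hc hδ (hsep _ (hKs 0) _ (hKs 3) K03).1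
  choose V hV hVl hVu using fun i => fiber_real mΩ (Ks i) (J (Ks i)) (hJ _ (hK i))
  have mS : ∀ i, MeasurableSet (Ωδ (Ks i)) := fun i => (hΩδ _ (hK i)).1
  have sS : ∀ i, Ωδ (Ks i) ⊆ fiberPiece Ω (Ks i) := fun i => (hΩδ _ (hK i)).2.1
  choose T hTc hT using fun i => (hΩδ _ (hK i)).2.2.1
  have bd : ∀ i, eLpNorm (extOp (chi (Ωδ (Ks i)))) (ENNReal.ofReal (2 * s)) volume ≤
      ENNReal.ofReal (C₁ * δ) * volume (fiberPiece Ω (Ks i)) ^ τ :=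
    fun i => (hΩδ _ (hK i)).2.2.2 _ subset_rfl (mS i)
  clear hΩδ hJ hsep hfar
  have fS : ∀ i, volume (Ωδ (Ks i)) ≠ ∞ := fun i =>
    measure_ne_top_of_subset (sS i) (by rw [hV i]; exact ENNReal.ofReal_ne_top)
  have V0 : ∀ i, 0 < V i := fun i => by
    have : (0 : ℝ) < (2 : ℝ) ^ (-((J (Ks i) : ℝ) + Ks i)) := by positivity
    linarith [hVl i]
  have mm : ∀ i, (Ks 0 : ℝ) + J (Ks 0) ≤ Ks i + J (Ks i) := fun i => by exact_mod_cast hmin i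
  set E : Fin 4 → ℝ × ℝ × ℝ → ℂ := fun i => extOp (chi (Ωδ (Ks i))) with hE
  have mE : ∀ i, StronglyMeasurable (E i) := fun i => sm_extOp (mS i)
  by_cases hT0 : T 0 = ∅
  · have h0 : Ωδ (Ks 0) = ∅ := by
      apply subset_empty_iff.1
      have := hT 0
      rw [hT0] at this
      simpa using this
    have : (fun p => ∏ i, extOp (chi (Ωδ (Ks i))) p) = fun _ => 0 := by
      funext p
      apply Finset.prod_eq_zero (Finset.mem_univ 0)
      rw [h0, extOp_empty]
    rw [this]
    simp
  have hδC : δ ≤ C₁ ^ (1 / C₂) := by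
    apply delta_small hC₁ hC₂ hδ
    refine le_trans ?_ (hTc 0)
    exact_mod_cast Finset.card_pos.2 (Finset.nonempty_iff_ne_empty.2 hT0)
  -- general single-function bound
  have single : ∀ i (t : ℝ), t ≤ (Ks i + J (Ks i) : ℝ) - (Ks 0 + J (Ks 0)) →
      eLpNorm (E i) (ENNReal.ofReal (2 * s)) volume ≤
        ENNReal.ofReal (M * (2 : ℝ) ^ (-(τ * t)) * V 0 ^ τ) := by
    intro i t ht
    refine (bd i).trans ?_
    rw [hV i, ENNReal.ofReal_rpow_of_pos (V0 i), ← ENNReal.ofReal_mul (by positivity)]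
    apply ENNReal.ofReal_le_ofReal
    have v1 : V i ≤ 16 * (2 : ℝ) ^ (-t) * V 0 := by
      have e1 : (2 : ℝ) ^ (-((J (Ks i) : ℝ) + Ks i)) ≤ (2 : ℝ) ^ (-t) * (2 : ℝ) ^ (-((J (Ks 0) : ℝ) + Ks 0)) := by
        rw [← Real.rpow_add (by norm_num)]
        apply Real.rpow_le_rpow_of_exponent_le (by norm_num)
        linarith
      have e2 : (2 : ℝ) ^ (-t) * (2 : ℝ) ^ (-((J (Ks 0) : ℝ) + Ks 0)) ≤ (2 : ℝ) ^ (-t) * (4 * V 0) :=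
        mul_le_mul_of_nonneg_left (hVl 0) (by positivity)
      linarith [hVu i]
    have v2 : V i ^ τ ≤ 16 ^ τ * (2 : ℝ) ^ (-(τ * t)) * V 0 ^ τ := by
      refine (Real.rpow_le_rpow (V0 i).le v1 τ0.le).trans (le_of_eq ?_)
      rw [Real.mul_rpow (by positivity) (V0 0).le, Real.mul_rpow (by positivity) (by positivity),
        ← Real.rpow_mul (by norm_num)]
      ring_nf
    calc C₁ * δ * V i ^ τ ≤ C₁ * C₁ ^ (1 / C₂) * (16 ^ τ * (2 : ℝ) ^ (-(τ * t)) * V 0 ^ τ) := by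
          gcongr
          exact Real.rpow_nonneg (V0 i).le _
      _ = _ := by rw [hM]; ring
  have single0 : ∀ i, eLpNorm (E i) (ENNReal.ofReal (2 * s)) volume ≤ ENNReal.ofReal (M * V 0 ^ τ) := by
    intro i
    have := single i 0 (by linarith [mm i])
    simpa using this
  have V00 := V0 0
  have vv : V 0 ^ τ * V 0 ^ τ = V 0 ^ (2 * τ) := by rw [← Real.rpow_add V00]; ring_nf
  have p12 : eLpNorm (fun x => E 1 x * E 2 x) (ENNReal.ofReal s) volume ≤
      ENNReal.ofReal (M ^ 2 * V 0 ^ (2 * τ)) := by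
    refine (holder2 s0 (mE 1) (mE 2)).trans ((mul_le_mul' (single0 1) (single0 2)).trans (le_of_eq ?_))
    rw [← ENNReal.ofReal_mul (by positivity), ← vv]
    congr 1
    ring
  have near_fin : ∀ T₁ T₂ : Finset (ℤ × ℤ), (T₁.card : ℝ) ≤ C₁ * δ ^ (-C₂) → (T₂.card : ℝ) ≤ C₁ * δ ^ (-C₂) →
      (T₁.card : ℝ≥0∞) * (T₂.card *
        ENNReal.ofReal (C * (2 : ℝ) ^ (-(c * N)) * ((2 : ℝ) ^ (-((J (Ks 0) : ℝ) + Ks 0))) ^ (2 * τ))) ≤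
      ENNReal.ofReal (B * (2 : ℝ) ^ (-(c₀ * N)) * V 0 ^ (2 * τ)) := by
    intro T₁ T₂ h1 h2
    rw [← ENNReal.ofReal_natCast, ← ENNReal.ofReal_natCast, ← ENNReal.ofReal_mul (by positivity),
      ← ENNReal.ofReal_mul (by positivity)]
    apply ENNReal.ofReal_le_ofReal
    have a1 : ((2 : ℝ) ^ (-((J (Ks 0) : ℝ) + Ks 0))) ^ (2 * τ) ≤ 4 ^ (2 * τ) * V 0 ^ (2 * τ) := by
      rw [← Real.mul_rpow (by norm_num) V00.le]
      exact Real.rpow_le_rpow (by positivity) (hVl 0) (by positivity)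
    calc (T₁.card : ℝ) * (T₂.card * (C * (2 : ℝ) ^ (-(c * N)) * ((2 : ℝ) ^ (-((J (Ks 0) : ℝ) + Ks 0))) ^ (2 * τ)))
        ≤ (C₁ * δ ^ (-C₂)) * ((C₁ * δ ^ (-C₂)) * (C * (2 : ℝ) ^ (-(c * N)) * (4 ^ (2 * τ) * V 0 ^ (2 * τ)))) := by
          gcongr
      _ = C₁ ^ 2 * C * 4 ^ (2 * τ) * ((δ ^ (-C₂) * δ ^ (-C₂)) * (2 : ℝ) ^ (-(c * N))) * V 0 ^ (2 * τ) := by ring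
      _ ≤ C₁ ^ 2 * C * 4 ^ (2 * τ) * ((2 : ℝ) ^ (c / 2 * N) * (2 : ℝ) ^ (-(c * N))) * V 0 ^ (2 * τ) := by gcongr
      _ ≤ B * (2 : ℝ) ^ (-(c₀ * N)) * V 0 ^ (2 * τ) := by
          rw [← Real.rpow_add (by norm_num)]
          have : c₀ * N ≤ c / 2 * N := mul_le_mul_of_nonneg_right (min_le_left _ _) N0
          gcongr
          · rw [hB]; nlinarith [sq_nonneg M]
          · norm_num
          · linarith
  have p03 : eLpNorm (fun x => E 0 x * E 3 x) (ENNReal.ofReal s) volume ≤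
      ENNReal.ofReal (B * (2 : ℝ) ^ (-(c₀ * N)) * V 0 ^ (2 * τ)) := by
    by_cases hD : N / 2 ≤ (Ks 3 + J (Ks 3) : ℝ) - (Ks 0 + J (Ks 0))
    · refine (holder2 s0 (mE 0) (mE 3)).trans ((mul_le_mul' (single0 0) (single 3 _ hD)).trans ?_)
      rw [← ENNReal.ofReal_mul (by positivity)]
      apply ENNReal.ofReal_le_ofReal
      rw [← vv]
      have : c₀ * N ≤ τ / 2 * N := mul_le_mul_of_nonneg_right (min_le_right _ _) N0
      calc M * V 0 ^ τ * (M * (2 : ℝ) ^ (-(τ * (N / 2))) * V 0 ^ τ)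
          = M ^ 2 * (2 : ℝ) ^ (-(τ * (N / 2))) * (V 0 ^ τ * V 0 ^ τ) := by ring
        _ ≤ _ := by
          have h1 : (2 : ℝ) ^ (-(τ * (N / 2))) ≤ (2 : ℝ) ^ (-(c₀ * N)) :=
            Real.rpow_le_rpow_of_exponent_le (by norm_num) (by linarith)
          have h2 : M ^ 2 ≤ B := by
            rw [hB]
            have : 0 < C₁ ^ 2 * C * 4 ^ (2 * τ) := by positivity
            linarith
          exact mul_le_mul_of_nonneg_right (mul_le_mul h2 h1 (by positivity) B0.le) (by positivity)
    · push Not at hD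
      rcases lt_or_gt_of_ne K03 with hlt | hlt
      · have hlt' : (Ks 0 : ℝ) < Ks 3 := by exact_mod_cast hlt
        have eN : N = Ks 3 - Ks 0 := by rw [hN, abs_of_neg (by linarith)]; ring
        refine (NP (J₁ := J (Ks 0)) (K₁ := Ks 0) (J₂ := J (Ks 3)) (K₂ := Ks 3) (N := N)
          (e := (J (Ks 0) : ℝ) + Ks 0) N0 ?_ ?_ ?_ ?_ ?_ (mS 0) (mS 3) (fS 0) (fS 3)
          (hT 0) (hT 3)).trans (near_fin _ _ (hTc 0) (hTc 3))
        all_goals linarith [mm 3]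
      · have hlt' : (Ks 3 : ℝ) < Ks 0 := by exact_mod_cast hlt
        have eN : N = Ks 0 - Ks 3 := by rw [hN, abs_of_pos (by linarith)]
        have := (NP (J₁ := J (Ks 3)) (K₁ := Ks 3) (J₂ := J (Ks 0)) (K₂ := Ks 0) (N := N)
          (e := (J (Ks 0) : ℝ) + Ks 0) N0 (by linarith [mm 3]) (by linarith [mm 3]) (by linarith [mm 3])
          (by linarith [mm 3]) (by linarith [mm 3]) (mS 3) (mS 0) (fS 3) (fS 0)
          (hT 3) (hT 0)).trans (near_fin _ _ (hTc 3) (hTc 0))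
        have ec : (fun x => E 0 x * E 3 x) = fun x => E 3 x * E 0 x := by
          funext x; exact mul_comm _ _
        rw [ec]
        exact this
  have split : (fun p => ∏ i, extOp (chi (Ωδ (Ks i))) p) =
      fun p => (E 0 p * E 3 p) * (E 1 p * E 2 p) := by
    funext p
    rw [Fin.prod_univ_four]
    simp only [hE]
    ring
  rw [split]
  have hh := holder2 (s := s / 2) (by positivity) ((mE 0).mul (mE 3)) ((mE 1).mul (mE 2))
  rw [show 2 * (s / 2) = s by ring] at hh
  refine hh.trans ((mul_le_mul' p03 p12).trans (le_of_eq ?_))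
  rw [hV 0, ENNReal.ofReal_rpow_of_pos V00, ← ENNReal.ofReal_mul (by positivity),
    ← ENNReal.ofReal_mul (by positivity)]
  congr 1
  rw [show 4 * τ = 2 * τ + 2 * τ by ring, Real.rpow_add V00]
  ring
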